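/- arXiv:1911.00680 — 15 statements merged into one kernel-verified Lean document; each statement's English description precedes it below -/
import Mathlib

section
/- Let G be a countable group acting by homeomorphisms on a compact Hausdorff space X. Then the set X₀ of points without holonomy is a residual (comeager) subset of X; in particular it contains a dense Gδ subset of X. -/
theorem IsClosed.compl_frontier_mem_residual {X : Type*} [TopologicalSpace X] {s : Set X}
    (hs : IsClosed s) : (frontier s)ᶜ ∈ residual X :=
  residual_of_dense_open isClosed_frontier.isOpen_compl
    (interior_eq_empty_iff_dense_compl.mp (interior_frontier hs))

/-- For a countable group acting by homeomorphisms on a compact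
Hausdorff space, the set of points without holonomy is residual (comeager). -/
theorem statement0 {X : Type*} [TopologicalSpace X] [CompactSpace X] [T2Space X]
    {G : Type*} [Group G] [Countable G] [MulAction G X]
    (hcont : ∀ g : G, Continuous fun x : X => g • x) :
    {x : X | ∀ g : G, g • x = x →
        ∃ U : Set X, IsOpen U ∧ x ∈ U ∧ ∀ y ∈ U, g • y = y} ∈ residual X := by
  have hclosed (g : G) : IsClosed {x : X | g • x = x} := isClosed_eq (hcont g) continuous_id
  filter_upwards [eventually_countable_forall.mpr
    fun g : G => (hclosed g).compl_frontier_mem_residual] with x hx g hgx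
  have hint : x ∈ interior {x : X | g • x = x} := by
    by_contra h
    exact hx g ((hclosed g).frontier_eq ▸ ⟨hgx, h⟩)
  exact ⟨_, isOpen_interior, hint, fun y hy => interior_subset (s := {x : X | g • x = x}) hy⟩
end

section
/- Let X be a Cantor set with a fixed compatible metric, and let G be a countable group acting minimally on X by homeomorphisms. Then the action is equicontinuous if and only if for every clopen subset U ⊆ X the orbit {g·U : g ∈ G} of U under the induced action on clopen sets is finite. -/
theorem mem_image_smul_iff {X G : Type*} [Group G] [MulAction G X] (g : G) (U : Set X) (x : X) :
    x ∈ (fun x : X => g • x) '' U ↔ g⁻¹ • x ∈ U := by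
  constructor
  · rintro ⟨y, hy, rfl⟩
    simpa using hy
  · intro h
    exact ⟨g⁻¹ • x, h, smul_inv_smul g x⟩

/-- Clopen sets have finite orbit under an equicontinuous action on a compact metric space. -/
theorem finite_range_image_smul_of_equicontinuous {X G : Type*} [MetricSpace X] [CompactSpace X]
    [Group G] [MulAction G X] (h : Equicontinuous (fun g : G => fun x : X => g • x))
    {U : Set X} (hU : IsClopen U) :
    (Set.range fun g : G => (fun x : X => g • x) '' U).Finite := by
  obtain ⟨δ, hδ, hδU⟩ := hU.isClosed.isCompact.exists_thickening_subset_open hU.isOpen subset_rfl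
  have hstable : ∀ x y : X, dist x y < δ → y ∈ U → x ∈ U := fun x y hxy hy =>
    hδU (Metric.mem_thickening_iff.2 ⟨y, hy, hxy⟩)
  have hunif := CompactSpace.uniformEquicontinuous_of_equicontinuous h
  obtain ⟨η, hη, hηδ⟩ := Metric.uniformEquicontinuous_iff.1 hunif δ hδ
  obtain ⟨t, -, ht, htcover⟩ := (isCompact_univ (X := X)).finite_cover_balls hη
  have hmem : ∀ (g : G) (x y : X), dist x y < η →
      (x ∈ (fun x : X => g • x) '' U ↔ y ∈ (fun x : X => g • x) '' U) := by
    intro g x y hxy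
    rw [mem_image_smul_iff, mem_image_smul_iff]
    exact ⟨hstable _ _ (hηδ y x (by rwa [dist_comm]) g⁻¹), hstable _ _ (hηδ x y hxy g⁻¹)⟩
  refine Set.Finite.of_injOn (f := fun V => V ∩ t) (t := t.powerset)
    (fun V _ => Set.inter_subset_right) ?_ ht.finite_subsets
  rintro _ ⟨g, rfl⟩ _ ⟨k, rfl⟩ hgk
  ext x
  obtain ⟨y, hy, hxy⟩ := Set.mem_iUnion₂.1 (htcover (Set.mem_univ x))
  have hyt := Set.ext_iff.1 hgk y
  simp only [Set.mem_inter_iff, hy, and_true] at hyt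
  exact (hmem g x y hxy).trans (hyt.trans (hmem k x y hxy).symm)

/-- An action by continuous maps on a compact totally disconnected metric space is equicontinuous
if every clopen set has finite orbit. -/
theorem equicontinuous_smul_of_finite_range_image {X G : Type*} [MetricSpace X] [CompactSpace X]
    [TotallyDisconnectedSpace X] [Group G] [MulAction G X]
    (hcont : ∀ g : G, Continuous fun x : X => g • x)
    (hfin : ∀ U : Set X, IsClopen U →
      (Set.range fun g : G => (fun x : X => g • x) '' U).Finite) :
    Equicontinuous (fun g : G => fun x : X => g • x) := by
  intro x
  rw [Metric.equicontinuousAt_iff_right]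
  intro ε hε
  have hnhds : ∀ z : X, ∃ V : Set X, IsClopen V ∧ z ∈ V ∧ V ⊆ Metric.ball z (ε / 2) := fun z =>
    compact_exists_isClopen_in_isOpen Metric.isOpen_ball (Metric.mem_ball_self (half_pos hε))
  choose V hV hzV hVball using hnhds
  obtain ⟨t, ht⟩ := (isCompact_univ (X := X)).elim_finite_subcover V (fun z => (hV z).isOpen)
    fun z _ => Set.mem_iUnion.2 ⟨z, hzV z⟩
  have hnear : ∀ z ∈ t, ∀ᶠ y in nhds x,
      ∀ W ∈ Set.range (fun g : G => (fun x : X => g • x) '' V z), x ∈ W → y ∈ W := by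
    intro z _
    rw [Filter.eventually_all_finite (hfin _ (hV z))]
    rintro _ ⟨g, rfl⟩
    by_cases hx : x ∈ (fun x : X => g • x) '' V z
    · have hpre : (fun y : X => g⁻¹ • y) ⁻¹' V z ∈ nhds x :=
        ((hV z).isOpen.preimage (hcont g⁻¹)).mem_nhds ((mem_image_smul_iff g _ x).1 hx)
      filter_upwards [hpre] with y hy _
      exact (mem_image_smul_iff g _ y).2 hy
    · exact Filter.Eventually.of_forall fun y h => absurd h hx
  filter_upwards [(Filter.eventually_all_finset t).2 hnear] with y hy g
  obtain ⟨z, hz, hgx⟩ := Set.mem_iUnion₂.1 (ht (Set.mem_univ (g • x)))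
  have hgy := hy z hz _ ⟨g⁻¹, rfl⟩ ((mem_image_smul_iff _ _ _).2 (by rwa [inv_inv]))
  rw [mem_image_smul_iff, inv_inv] at hgy
  have hx := Metric.mem_ball.1 (hVball z hgx)
  have hy' := Metric.mem_ball'.1 (hVball z hgy)
  linarith [dist_triangle (g • x) z (g • y)]


/-- A minimal action of a countable group on a Cantor set (with a fixed
compatible metric) is equicontinuous iff the orbit of every clopen set under the induced
action on clopen sets is finite. -/
theorem statement1 {X : Type*} [MetricSpace X] [CompactSpace X] [Nonempty X]
    [TotallyDisconnectedSpace X] (hperf : Perfect (Set.univ : Set X))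
    {G : Type*} [Group G] [Countable G] [MulAction G X]
    (hcont : ∀ g : G, Continuous fun x : X => g • x)
    (hmin : ∀ x : X, Dense (MulAction.orbit G x)) :
    Equicontinuous (fun g : G => fun x : X => g • x) ↔
      ∀ U : Set X, IsClopen U →
        (Set.range fun g : G => (fun x : X => g • x) '' U).Finite := by
  exact ⟨fun h _ hU => finite_range_image_smul_of_equicontinuous h hU,
    equicontinuous_smul_of_finite_range_image hcont⟩
end

section
/- Let X be a Cantor set and let G be a countable group acting minimally and equicontinuously on X by homeomorphisms. Then for every x ∈ X there exists a sequence (U_ℓ)_{ℓ≥0} of adapted clopen subsets of X such that x ∈ U_{ℓ+1} ⊊ U_ℓ for all ℓ ≥ 0 and ⋂_{ℓ≥0} U_ℓ = {x}. -/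
open Set Filter Topology Uniformity

/-- The entourage of pairs which a clopen subset of a compact space does not separate. -/
theorem IsClopen.setOf_mem_iff_mem_mem_uniformity {X : Type*} [UniformSpace X] [CompactSpace X]
    {W : Set X} (hW : IsClopen W) : {p : X × X | p.1 ∈ W ↔ p.2 ∈ W} ∈ 𝓤 X := by
  rw [← nhdsSet_diagonal_eq_uniformity]
  have hrel : {p : X × X | p.1 ∈ W ↔ p.2 ∈ W} = W ×ˢ W ∪ Wᶜ ×ˢ Wᶜ := by
    ext p
    simp only [mem_ofPred_eq, mem_union, mem_prod, mem_compl_iff]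
    tauto
  refine IsOpen.mem_nhdsSet ?_ |>.2 ?_
  · rw [hrel]
    exact (hW.isOpen.prod hW.isOpen).union (hW.compl.isOpen.prod hW.compl.isOpen)
  · rintro ⟨a, b⟩ (rfl : a = b)
    exact Iff.rfl

/-- The points which visit `W` along the same elements of `G` as `x` does. -/
def itineraryClass (G : Type*) {X : Type*} [SMul G X] (W : Set X) (x : X) : Set X :=
  {y | ∀ g : G, g • x ∈ W ↔ g • y ∈ W}

section ItineraryClass

variable {G X : Type*}

theorem mem_itineraryClass_self [SMul G X] (W : Set X) (x : X) : x ∈ itineraryClass G W x :=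
  fun _ => Iff.rfl

theorem itineraryClass_eq_of_mem [SMul G X] {W : Set X} {x y : X}
    (h : y ∈ itineraryClass G W x) : itineraryClass G W y = itineraryClass G W x :=
  Set.ext fun _ => forall_congr' fun g => by rw [h g]

theorem itineraryClass_subset [Monoid G] [MulAction G X] {W : Set X} {x : X} (hx : x ∈ W) :
    itineraryClass G W x ⊆ W := fun y hy => by
  simpa [hx] using hy 1

theorem image_smul_itineraryClass [Group G] [MulAction G X] (W : Set X) (x : X) (g : G) :
    (fun y : X => g • y) '' itineraryClass G W x = itineraryClass G W (g • x) := by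
  ext z
  constructor
  · rintro ⟨y, hy, rfl⟩ h
    simpa only [mul_smul] using hy (h * g)
  · intro hz
    refine ⟨g⁻¹ • z, fun h => ?_, smul_inv_smul g z⟩
    simpa only [mul_smul, inv_smul_smul] using hz (h * g⁻¹)

theorem image_smul_itineraryClass_eq_self [Group G] [MulAction G X] {W : Set X} {x : X} {g : G}
    (h : ((fun y : X => g • y) '' itineraryClass G W x ∩ itineraryClass G W x).Nonempty) :
    (fun y : X => g • y) '' itineraryClass G W x = itineraryClass G W x := by
  rw [image_smul_itineraryClass] at h ⊢
  obtain ⟨z, hz, hz'⟩ := h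
  rw [← itineraryClass_eq_of_mem hz, itineraryClass_eq_of_mem hz']

theorem isClopen_itineraryClass [SMul G X] [UniformSpace X] [CompactSpace X]
    (hequi : Equicontinuous (fun g : G => fun x : X => g • x)) {W : Set X} (hW : IsClopen W)
    (x : X) : IsClopen (itineraryClass G W x) := by
  have hnhds (y : X) : itineraryClass G W y ∈ 𝓝 y :=
    hequi y _ hW.setOf_mem_iff_mem_mem_uniformity
  constructor
  · rw [← isOpen_compl_iff, isOpen_iff_mem_nhds]
    refine fun y hy => mem_of_superset (hnhds y) fun z hz hzx => hy ?_
    rw [← itineraryClass_eq_of_mem hzx, itineraryClass_eq_of_mem hz]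
    exact mem_itineraryClass_self W y
  · rw [isOpen_iff_mem_nhds]
    exact fun y hy => itineraryClass_eq_of_mem hy ▸ hnhds y

/-- Every point of a Stone space with an equicontinuous action has a neighborhood basis of
adapted clopen sets. -/
theorem exists_isClopen_adapted_subset [Group G] [MulAction G X] [UniformSpace X]
    [CompactSpace X] [T2Space X] [TotallyDisconnectedSpace X]
    (hequi : Equicontinuous (fun g : G => fun x : X => g • x)) {x : X} {O : Set X}
    (hO : O ∈ 𝓝 x) :
    ∃ U : Set X, IsClopen U ∧ x ∈ U ∧ U ⊆ O ∧
      ∀ g : G, ((fun y : X => g • y) '' U ∩ U).Nonempty → (fun y : X => g • y) '' U = U := by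
  obtain ⟨V, hVO, hV, hxV⟩ := mem_nhds_iff.1 hO
  obtain ⟨W, hW, hxW, hWV⟩ := compact_exists_isClopen_in_isOpen hV hxV
  exact ⟨itineraryClass G W x, isClopen_itineraryClass hequi hW x, mem_itineraryClass_self W x,
    (itineraryClass_subset hxW).trans (hWV.trans hVO),
    fun _ => image_smul_itineraryClass_eq_self⟩

end ItineraryClass


/-- For a minimal equicontinuous action of a countable group on a Cantor set,
every point admits an adapted neighborhood basis: a strictly decreasing sequence of adapted
clopen sets containing the point and intersecting in exactly that point.
A clopen set `U` is adapted if it is nonempty and for every `g ∈ G`, if `g·U` meets `U`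
then `g·U = U`. -/
theorem statement2 {X : Type*} [MetricSpace X] [CompactSpace X] [Nonempty X]
    [TotallyDisconnectedSpace X] (hperf : Perfect (Set.univ : Set X))
    {G : Type*} [Group G] [Countable G] [MulAction G X]
    (hcont : ∀ g : G, Continuous fun x : X => g • x)
    (hmin : ∀ x : X, Dense (MulAction.orbit G x))
    (hequi : Equicontinuous (fun g : G => fun x : X => g • x))
    (x : X) :
    ∃ U : ℕ → Set X,
      (∀ ℓ : ℕ, IsClopen (U ℓ) ∧ (U ℓ).Nonempty ∧
        ∀ g : G, ((fun y : X => g • y) '' U ℓ ∩ U ℓ).Nonempty →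
          (fun y : X => g • y) '' U ℓ = U ℓ) ∧
      (∀ ℓ : ℕ, x ∈ U (ℓ + 1) ∧ U (ℓ + 1) ⊂ U ℓ) ∧
      (⋂ ℓ : ℕ, U ℓ) = {x} := by
  let P := {U : Set X // IsClopen U ∧ x ∈ U ∧
    ∀ g : G, ((fun y : X => g • y) '' U ∩ U).Nonempty → (fun y : X => g • y) '' U = U}
  have step (n : ℕ) (U : P) :
      ∃ V : P, V.1 ⊂ U.1 ∧ V.1 ⊆ Metric.ball x (1 / ((n : ℝ) + 1)) := by
    obtain ⟨U, hU, hxU, -⟩ := U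
    obtain ⟨y, ⟨hyU, -⟩, hyx⟩ :=
      accPt_iff_nhds.1 (hperf.acc x (mem_univ x)) U (hU.isOpen.mem_nhds hxU)
    obtain ⟨V, hV, hxV, hVO, hVad⟩ := exists_isClopen_adapted_subset hequi
      (inter_mem (inter_mem (hU.isOpen.mem_nhds hxU) (isOpen_compl_singleton.mem_nhds hyx.symm))
        (Metric.ball_mem_nhds x (Nat.one_div_pos_of_nat (α := ℝ) (n := n))))
    exact ⟨⟨V, hV, hxV, hVad⟩,
      (ssubset_iff_of_subset fun z hz => (hVO hz).1.1).2 ⟨y, hyU, fun hy => (hVO hy).1.2 rfl⟩,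
      fun z hz => (hVO hz).2⟩
  choose next hnext_ssubset hnext_ball using step
  let U : ℕ → P := Nat.rec
    ⟨univ, isClopen_univ, mem_univ x, fun g _ => image_univ_of_surjective (MulAction.surjective g)⟩
    next
  refine ⟨fun n => (U n).1, fun n => ⟨(U n).2.1, ⟨x, (U n).2.2.1⟩, (U n).2.2.2⟩,
    fun n => ⟨(U (n + 1)).2.2.1, hnext_ssubset n (U n)⟩, ?_⟩
  refine Subset.antisymm (fun y hy => ?_)
    (singleton_subset_iff.2 (mem_iInter.2 fun n => (U n).2.2.1))
  by_contra hyx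
  obtain ⟨n, hn⟩ := exists_nat_one_div_lt (dist_pos.2 hyx)
  exact lt_asymm hn (hnext_ball n (U n) (mem_iInter.1 hy (n + 1)))
end

section
/- Let X be a Cantor set with a fixed compatible metric and let G be a finitely generated group acting minimally and equicontinuously on X by homeomorphisms. If the action is locally quasi-analytic, then the set {G_x : x ∈ X₀} of stabilizers of points without holonomy is finite, and any two subgroups in this set are conjugate in G; in particular, the stabilizer of every point without holonomy is conjugate to the stabilizer of any other point without holonomy. -/
/-- A point `x` is without holonomy: every group element fixing `x` fixes pointwise an
open neighborhood of `x`. -/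
def WithoutHolonomy (G : Type*) {X : Type*} [Group G] [TopologicalSpace X]
    [MulAction G X] (x : X) : Prop :=
  ∀ g : G, g • x = x → ∃ U : Set X, IsOpen U ∧ x ∈ U ∧ ∀ y ∈ U, g • y = y

/-- The action is locally quasi-analytic: elements agreeing on a nonempty open subset of a
set of diameter `< ε` agree on the whole set. -/
def IsLQA (G : Type*) (X : Type*) [Group G] [MetricSpace X] [MulAction G X] : Prop :=
  ∃ ε : ℝ, 0 < ε ∧ ∀ U : Set X, IsOpen U → Metric.diam U < ε →
    ∀ V : Set X, V ⊆ U → IsOpen V → V.Nonempty →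
      ∀ g₁ g₂ : G, (∀ v ∈ V, g₁ • v = g₂ • v) → ∀ u ∈ U, g₁ • u = g₂ • u

/-- Two subgroups of `G` are conjugate. -/
def SubgroupConj {G : Type*} [Group G] (H K : Subgroup G) : Prop :=
  ∃ g : G, Subgroup.map (MulAut.conj g).toMonoidHom H = K

theorem WithoutHolonomy.smul {G X : Type*} [Group G] [TopologicalSpace X] [MulAction G X]
    (hcont : ∀ g : G, Continuous fun x : X => g • x) {x : X} (hx : WithoutHolonomy G x)
    (g : G) : WithoutHolonomy G (g • x) := by
  intro h hh
  obtain ⟨U, hU, hxU, hfix⟩ := hx (g⁻¹ * h * g) (by rw [mul_smul, mul_smul, hh, inv_smul_smul])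
  refine ⟨(fun y => g⁻¹ • y) ⁻¹' U, hU.preimage (hcont _), by simpa using hxU, fun y hy => ?_⟩
  have := hfix _ hy
  rwa [mul_smul, mul_smul, smul_inv_smul, smul_left_cancel_iff] at this

/-- In a locally quasi-analytic action, the stabilizer of a point without holonomy in a small
ball is the pointwise fixer of that ball. -/
theorem IsLQA.exists_stabilizer_eq_fixingSubgroup {G X : Type*} [Group G] [MetricSpace X]
    [MulAction G X] (h : IsLQA G X) :
    ∃ r : ℝ, 0 < r ∧ ∀ c x : X, x ∈ Metric.ball c r → WithoutHolonomy G x →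
      MulAction.stabilizer G x = fixingSubgroup G (Metric.ball c r) := by
  obtain ⟨ε, hε, H⟩ := h
  refine ⟨ε / 3, by positivity, fun c x hxc hx => ?_⟩
  have hdiam : Metric.diam (Metric.ball c (ε / 3)) < ε :=
    (Metric.diam_ball (by positivity)).trans_lt (by linarith)
  ext g
  rw [MulAction.mem_stabilizer_iff, mem_fixingSubgroup_iff]
  refine ⟨fun hg u hu => ?_, fun hg => hg x hxc⟩
  obtain ⟨V, hV, hxV, hfix⟩ := hx g hg
  simpa using H _ Metric.isOpen_ball hdiam (V ∩ Metric.ball c (ε / 3)) Set.inter_subset_right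
    (hV.inter Metric.isOpen_ball) ⟨x, hxV, hxc⟩ g 1 (fun v hv => by simpa using hfix v hv.1) u hu

/-- For a locally quasi-analytic minimal equicontinuous action of a finitely
generated group on a Cantor set, the set of stabilizers of points without holonomy is a
finite set of pairwise conjugate subgroups. -/
theorem statement3 {X : Type*} [MetricSpace X] [CompactSpace X] [Nonempty X]
    [TotallyDisconnectedSpace X] (hperf : Perfect (Set.univ : Set X))
    {G : Type*} [Group G] (hfg : Group.FG G) [MulAction G X]
    (hcont : ∀ g : G, Continuous fun x : X => g • x)
    (hmin : ∀ x : X, Dense (MulAction.orbit G x))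
    (hequi : Equicontinuous (fun g : G => fun x : X => g • x))
    (hlqa : IsLQA G X) :
    ({H : Subgroup G | ∃ x : X, WithoutHolonomy G x ∧ H = MulAction.stabilizer G x}).Finite ∧
      ∀ x y : X, WithoutHolonomy G x → WithoutHolonomy G y →
        SubgroupConj (MulAction.stabilizer G x) (MulAction.stabilizer G y) := by
  obtain ⟨r, hr, H⟩ := hlqa.exists_stabilizer_eq_fixingSubgroup
  constructor
  · obtain ⟨t, ht, hcover⟩ :=
      Metric.totallyBounded_iff.mp (isCompact_univ (X := X)).totallyBounded r hr
    refine (ht.image fun c => fixingSubgroup G (Metric.ball c r)).subset ?_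
    rintro _ ⟨x, hx, rfl⟩
    obtain ⟨c, hc, hxc⟩ := Set.mem_iUnion₂.mp (hcover (Set.mem_univ x))
    exact ⟨c, hc, (H c x hxc hx).symm⟩
  · intro x y hx hy
    obtain ⟨_, hz, g, rfl⟩ :=
      (hmin x).inter_open_nonempty _ Metric.isOpen_ball ⟨y, Metric.mem_ball_self hr⟩
    refine ⟨g, ?_⟩
    rw [← MulAction.stabilizer_smul_eq_stabilizer_map_conj,
      H y _ hz (hx.smul hcont g), H y y (Metric.mem_ball_self hr) hy]
end

section
/- Let X be a Cantor set with a fixed compatible metric and let G be a finitely generated group acting minimally and equicontinuously on X by homeomorphisms. If the action is not locally quasi-analytic, then for every point x ∈ X₀ without holonomy, the set {g·G_x·g⁻¹ : g ∈ G} of stabilizers of points in the orbit of x is infinite. -/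
/-- The points fixed by every element of a subgroup. -/
def subgroupFixedPoints {G : Type*} (X : Type*) [Group G] [MulAction G X]
    (S : Subgroup G) : Set X :=
  {z | ∀ s ∈ S, s • z = z}

theorem isClosed_subgroupFixedPoints {G X : Type*} [Group G] [TopologicalSpace X] [T2Space X]
    [MulAction G X] (hcont : ∀ g : G, Continuous fun x : X => g • x) (S : Subgroup G) :
    IsClosed (subgroupFixedPoints X S) := by
  simp only [subgroupFixedPoints, Set.ofPred_forall]
  exact isClosed_iInter fun s => isClosed_iInter fun _ => isClosed_eq (hcont s) continuous_id

theorem smul_mem_subgroupFixedPoints_stabilizer {G X : Type*} [Group G] [MulAction G X]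
    (g : G) {y z : X} (hz : z ∈ subgroupFixedPoints X (MulAction.stabilizer G y)) :
    g • z ∈ subgroupFixedPoints X (MulAction.stabilizer G (g • y)) := by
  intro s hs
  have h := hz (g⁻¹ * s * g) (by
    rw [MulAction.mem_stabilizer_iff] at hs ⊢
    rw [mul_smul, mul_smul, hs, inv_smul_smul])
  rwa [mul_smul, mul_smul, inv_smul_eq_iff] at h

/-- If a dense orbit has finitely many stabilizers, then some stabilizer of a point of the orbit
fixes a neighborhood of that point. -/
theorem exists_stabilizer_fixing_nhds {G X : Type*} [Group G] [TopologicalSpace X] [T2Space X]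
    [BaireSpace X] [MulAction G X] (hcont : ∀ g : G, Continuous fun x : X => g • x)
    {x : X} (hx : Dense (MulAction.orbit G x))
    (hfin : (Set.range fun g : G => MulAction.stabilizer G (g • x)).Finite) :
    ∃ a : G, subgroupFixedPoints X (MulAction.stabilizer G (a • x)) ∈ nhds (a • x) := by
  set F := Set.range fun g : G => MulAction.stabilizer G (g • x) with hF
  have hcover : ⋃ S : F, subgroupFixedPoints X (S : Subgroup G) = Set.univ := by
    have : Finite F := hfin
    have hclosed : IsClosed (⋃ S : F, subgroupFixedPoints X (S : Subgroup G)) :=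
      isClosed_iUnion_of_finite fun S => isClosed_subgroupFixedPoints hcont _
    refine Set.eq_univ_of_univ_subset ?_
    rw [← hx.closure_eq]
    refine hclosed.closure_subset_iff.2 ?_
    rintro _ ⟨g, rfl⟩
    exact Set.mem_iUnion.2 ⟨⟨_, g, rfl⟩, fun s hs => hs⟩
  have : Nonempty X := ⟨x⟩
  have : Countable F := hfin.countable
  obtain ⟨⟨_, c, rfl⟩, p, hp⟩ := nonempty_interior_of_iUnion_of_closed
    (fun S : F => isClosed_subgroupFixedPoints hcont (S : Subgroup G)) hcover
  obtain ⟨S, ⟨⟨b, rfl⟩, hmax⟩⟩ := hfin.exists_maximal (⟨_, c, rfl⟩ : F.Nonempty)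
  have hnhds : subgroupFixedPoints X (MulAction.stabilizer G (b • x)) ∈
      nhds ((b * c⁻¹) • p) := by
    have h1 : Filter.Tendsto (fun z : X => (b * c⁻¹)⁻¹ • z) (nhds ((b * c⁻¹) • p)) (nhds p) := by
      simpa only [inv_smul_smul] using (hcont (b * c⁻¹)⁻¹).tendsto ((b * c⁻¹) • p)
    filter_upwards [h1 (mem_interior_iff_mem_nhds.1 hp)] with z hz
    have := smul_mem_subgroupFixedPoints_stabilizer (b * c⁻¹) hz
    rwa [smul_inv_smul, smul_smul, inv_mul_cancel_right] at this
  obtain ⟨_, hw, a, rfl⟩ := hx.inter_open_nonempty _ isOpen_interior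
    ⟨_, mem_interior_iff_mem_nhds.2 hnhds⟩
  refine ⟨a, ?_⟩
  have hle : MulAction.stabilizer G (b • x) ≤ MulAction.stabilizer G (a • x) :=
    fun s hs => interior_subset hw s hs
  rw [← hle.antisymm (hmax ⟨a, rfl⟩ hle)]
  exact mem_interior_iff_mem_nhds.1 hw

/-- If a minimal equicontinuous action of a finitely generated group on a
Cantor set is not locally quasi-analytic, then for every point `x` without holonomy the
set of conjugates of the stabilizer of `x` (the stabilizers of points in the orbit of `x`)
is infinite. -/
theorem statement4 {X : Type*} [MetricSpace X] [CompactSpace X] [Nonempty X]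
    [TotallyDisconnectedSpace X] (hperf : Perfect (Set.univ : Set X))
    {G : Type*} [Group G] (hfg : Group.FG G) [MulAction G X]
    (hcont : ∀ g : G, Continuous fun x : X => g • x)
    (hmin : ∀ x : X, Dense (MulAction.orbit G x))
    (hequi : Equicontinuous (fun g : G => fun x : X => g • x))
    (hnlqa : ¬ IsLQA G X) :
    ∀ x : X, WithoutHolonomy G x →
      (Set.range fun g : G =>
        Subgroup.map (MulAut.conj g).toMonoidHom (MulAction.stabilizer G x)).Infinite := by
  intro x _ hfin
  simp only [← MulAction.stabilizer_smul_eq_stabilizer_map_conj] at hfin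
  obtain ⟨a, ha⟩ := exists_stabilizer_fixing_nhds hcont (hmin x) hfin
  obtain ⟨δ, hδ, hball⟩ := Metric.mem_nhds_iff.1 ha
  obtain ⟨ε, hε, hunif⟩ := Metric.uniformEquicontinuous_iff.1
    (CompactSpace.uniformEquicontinuous_of_equicontinuous hequi) δ hδ
  refine hnlqa ⟨ε, hε, fun U _ hdiam V hVU hV hVne g₁ g₂ hg u hu => ?_⟩
  obtain ⟨y, hyV, hy⟩ := (hmin (a • x)).inter_open_nonempty V hV hVne
  obtain ⟨b, rfl⟩ := hy
  have hyV' : b • a • x ∈ V := hyV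
  have hdist : dist u (b • a • x) < ε :=
    (Metric.dist_le_diam_of_mem (Metric.isBounded_of_compactSpace) hu (hVU hyV')).trans_lt hdiam
  have hmem := hunif _ _ hdist b⁻¹
  rw [inv_smul_smul] at hmem
  have hfix := smul_mem_subgroupFixedPoints_stabilizer b (hball hmem)
  rw [smul_inv_smul] at hfix
  have h := hfix (g₁⁻¹ * g₂) (by
    rw [MulAction.mem_stabilizer_iff, mul_smul, inv_smul_eq_iff]
    exact (hg _ hyV').symm)
  rw [mul_smul, inv_smul_eq_iff] at h
  exact h.symm
end

section
/- Let X be a Cantor set with a fixed compatible metric and let G be a finitely generated group acting minimally and equicontinuously on X by homeomorphisms. If the action is locally quasi-analytic, then there exists a subgroup H of G such that the set {x ∈ X : G_x is conjugate to H in G} is residual (comeager) in X. -/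
/-- A point `x` lies in the set when `f` moves it or fixes a neighbourhood of it pointwise; the
exceptional points form the frontier of the fixed-point set of `f`. -/
theorem residual_setOf_fixed_imp_eventually_fixed {X : Type*} [TopologicalSpace X] [T2Space X]
    {f : X → X} (hf : Continuous f) :
    {x : X | f x = x → ∀ᶠ z in nhds x, f z = z} ∈ residual X := by
  have hcl : IsClosed {x : X | f x = x} := isClosed_eq hf continuous_id
  have hfr : Dense (frontier {x : X | f x = x})ᶜ :=
    interior_eq_empty_iff_dense_compl.1 (interior_frontier hcl)
  filter_upwards [residual_of_dense_open isClosed_frontier.isOpen_compl hfr] with x hx hfx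
  have hint : x ∈ interior {x : X | f x = x} := by
    by_contra h
    exact hx ⟨subset_closure hfx, h⟩
  exact mem_interior_iff_mem_nhds.1 hint

/-- For a locally quasi-analytic minimal equicontinuous action of a finitely
generated group on a Cantor set, there is a subgroup `H` of `G` such that the set of points
whose stabilizer is conjugate to `H` is residual (comeager) in `X`. -/
theorem statement5 {X : Type*} [MetricSpace X] [CompactSpace X] [Nonempty X]
    [TotallyDisconnectedSpace X] (hperf : Perfect (Set.univ : Set X))
    {G : Type*} [Group G] (hfg : Group.FG G) [MulAction G X]
    (hcont : ∀ g : G, Continuous fun x : X => g • x)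
    (hmin : ∀ x : X, Dense (MulAction.orbit G x))
    (hequi : Equicontinuous (fun g : G => fun x : X => g • x))
    (hlqa : IsLQA G X) :
    ∃ H : Subgroup G,
      {x : X | ∃ g : G, Subgroup.map (MulAut.conj g).toMonoidHom H = MulAction.stabilizer G x}
        ∈ residual X := by
  have : Countable G := by
    obtain ⟨α, _, φ, hφ⟩ := Group.fg_iff_exists_freeGroup_hom_surjective_finite.1 hfg
    exact hφ.countable
  obtain ⟨ε, hε, hqa⟩ := hlqa
  obtain ⟨x₀⟩ := ‹Nonempty X›
  set U : Set X := Metric.ball x₀ (ε / 3)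
  have hdiam : Metric.diam U < ε :=
    (Metric.diam_ball (by positivity)).trans_lt (by linarith)
  refine ⟨fixingSubgroup G U, ?_⟩
  have hres : ∀ᶠ x in residual X, ∀ g : G, g • x = x → ∀ᶠ z in nhds x, g • z = z :=
    eventually_countable_forall.2 fun g => residual_setOf_fixed_imp_eventually_fixed (hcont g)
  filter_upwards [hres] with y hy
  obtain ⟨_, hgU, g, rfl⟩ :=
    (hmin y).inter_open_nonempty U Metric.isOpen_ball ⟨x₀, Metric.mem_ball_self (by positivity)⟩
  refine ⟨g⁻¹, Subgroup.ext fun k => ?_⟩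
  rw [Subgroup.mem_map_equiv, mem_fixingSubgroup_iff, MulAction.mem_stabilizer_iff]
  have hconj : (MulAut.conj g⁻¹).symm k = g * k * g⁻¹ := by simp
  rw [hconj]
  constructor
  · intro h
    simpa [mul_smul] using h _ hgU
  · intro hk
    obtain ⟨W, hW, hWo, hyW⟩ := eventually_nhds_iff.1 (hy k hk)
    have key := hqa U Metric.isOpen_ball hdiam (U ∩ (fun x => g⁻¹ • x) ⁻¹' W)
      Set.inter_subset_left (Metric.isOpen_ball.inter (hWo.preimage (hcont g⁻¹)))
      ⟨g • y, hgU, by simpa using hyW⟩ (g * k * g⁻¹) 1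
      (fun v hv => by rw [mul_smul, mul_smul, hW _ hv.2, smul_inv_smul, one_smul])
    simpa using key
end

section
/- Let n : ℕ → ℕ with n(ℓ) ≥ 2 for all ℓ, let X = Π_{ℓ∈ℕ} Fin(n(ℓ)) be the path space with product measure μ, and let G be a countable group acting minimally on X by tree automorphisms. If every element of G acts as a locally non-degenerate tree automorphism, then the set of points with non-trivial holonomy is μ-null; equivalently, the set X₀ of points without holonomy has full μ-measure. -/
open MeasureTheory ENNReal

/-- The cylinder set in the path space `Π k, Fin (n k)` determined by a finite word `w`
of length `ℓ`. -/
def Cyl (n : ℕ → ℕ) {ℓ : ℕ} (w : (i : Fin ℓ) → Fin (n i)) : Set (∀ k : ℕ, Fin (n k)) :=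
  {x | ∀ i : Fin ℓ, x i = w i}

/-- A tree automorphism of the path space: a bijection such that two paths agree in the
first `ℓ` coordinates iff their images do. -/
def IsTreeAut (n : ℕ → ℕ) (f : (∀ k : ℕ, Fin (n k)) → ∀ k : ℕ, Fin (n k)) : Prop :=
  Function.Bijective f ∧ ∀ (ℓ : ℕ) (x y : ∀ k : ℕ, Fin (n k)),
    (∀ i : Fin ℓ, x i = y i) ↔ (∀ i : Fin ℓ, f x i = f y i)

/-- A tree automorphism is locally non-degenerate: there is `0 < α ≤ 1` such that on any
cylinder which is fixed setwise but not pointwise, the set of moved points has measure at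
least `α` times the measure of the cylinder. -/
def LocNonDeg (n : ℕ → ℕ) (μ : Measure (∀ k : ℕ, Fin (n k)))
    (f : (∀ k : ℕ, Fin (n k)) → ∀ k : ℕ, Fin (n k)) : Prop :=
  ∃ α : ℝ≥0∞, 0 < α ∧ α ≤ 1 ∧ ∀ (ℓ : ℕ) (w : (i : Fin ℓ) → Fin (n i)),
    f '' Cyl n w = Cyl n w → (∃ u ∈ Cyl n w, f u ≠ u) →
      α * μ (Cyl n w) ≤ μ {u ∈ Cyl n w | f u ≠ u}

theorem mem_cyl_iff_eq (n : ℕ → ℕ) {ℓ : ℕ} (w : (i : Fin ℓ) → Fin (n i))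
    (x : ∀ k : ℕ, Fin (n k)) : x ∈ Cyl n w ↔ (fun i : Fin ℓ => x i) = w := by
  simp [Cyl, funext_iff]

theorem mem_cyl_self (n : ℕ → ℕ) (ℓ : ℕ) (x : ∀ k : ℕ, Fin (n k)) :
    x ∈ Cyl n (fun i : Fin ℓ => x i) := fun _ => rfl

theorem cyl_eq_piNat_cylinder (n : ℕ → ℕ) (ℓ : ℕ) (x : ∀ k : ℕ, Fin (n k)) :
    Cyl n (fun i : Fin ℓ => x i) = PiNat.cylinder x ℓ := by
  ext y
  exact ⟨fun h i hi => h ⟨i, hi⟩, fun h i => h i i.2⟩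

theorem isOpen_cyl (n : ℕ → ℕ) {ℓ : ℕ} (w : (i : Fin ℓ) → Fin (n i)) : IsOpen (Cyl n w) := by
  have h : Cyl n w = ⋂ i : Fin ℓ, (fun x : ∀ k : ℕ, Fin (n k) => x i) ⁻¹' {w i} := by
    ext x
    simp [Cyl]
  rw [h]
  exact isOpen_iInter_of_finite fun i =>
    (isOpen_discrete {w i}).preimage (continuous_apply (i : ℕ))

theorem exists_cyl_subset (n : ℕ → ℕ) {U : Set (∀ k : ℕ, Fin (n k))} (hU : IsOpen U)
    {x : ∀ k : ℕ, Fin (n k)} (hx : x ∈ U) : ∃ ℓ : ℕ, Cyl n (fun i : Fin ℓ => x i) ⊆ U := by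
  obtain ⟨_, ⟨y, ℓ, rfl⟩, hxy, hyU⟩ :=
    (PiNat.isTopologicalBasis_cylinders (fun k => Fin (n k))).exists_subset_of_mem_open hx hU
  refine ⟨ℓ, ?_⟩
  rwa [cyl_eq_piNat_cylinder, PiNat.mem_cylinder_iff_eq.1 hxy]

/-- The union of the level-`ℓ` cylinders that meet `A`. -/
def cylHull (n : ℕ → ℕ) (A : Set (∀ k : ℕ, Fin (n k))) (ℓ : ℕ) : Set (∀ k : ℕ, Fin (n k)) :=
  ⋃ w ∈ {w : (i : Fin ℓ) → Fin (n i) | (A ∩ Cyl n w).Nonempty}, Cyl n w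

theorem mem_cylHull (n : ℕ → ℕ) (A : Set (∀ k : ℕ, Fin (n k))) (ℓ : ℕ)
    (x : ∀ k : ℕ, Fin (n k)) :
    x ∈ cylHull n A ℓ ↔ (A ∩ Cyl n (fun i : Fin ℓ => x i)).Nonempty := by
  simp [cylHull, mem_cyl_iff_eq]

theorem subset_cylHull (n : ℕ → ℕ) (A : Set (∀ k : ℕ, Fin (n k))) (ℓ : ℕ) :
    A ⊆ cylHull n A ℓ := fun x hx =>
  (mem_cylHull n A ℓ x).2 ⟨x, hx, mem_cyl_self n ℓ x⟩

theorem isOpen_cylHull (n : ℕ → ℕ) (A : Set (∀ k : ℕ, Fin (n k))) (ℓ : ℕ) :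
    IsOpen (cylHull n A ℓ) :=
  isOpen_biUnion fun w _ => isOpen_cyl n w

theorem antitone_cylHull (n : ℕ → ℕ) (A : Set (∀ k : ℕ, Fin (n k))) :
    Antitone (cylHull n A) := by
  intro ℓ m h x hx
  rw [mem_cylHull] at hx ⊢
  obtain ⟨y, hyA, hy⟩ := hx
  exact ⟨y, hyA, fun i => hy ⟨i, i.2.trans_le h⟩⟩

theorem iInter_cylHull (n : ℕ → ℕ) {A : Set (∀ k : ℕ, Fin (n k))} (hA : IsClosed A) :
    ⋂ ℓ, cylHull n A ℓ = A := by
  refine Set.Subset.antisymm (fun x hx => ?_) (Set.subset_iInter (subset_cylHull n A))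
  by_contra hxA
  obtain ⟨ℓ, hℓ⟩ := exists_cyl_subset n hA.isOpen_compl hxA
  obtain ⟨y, hyA, hy⟩ := (mem_cylHull n A ℓ x).1 (Set.mem_iInter.1 hx ℓ)
  exact hℓ hy hyA

theorem pairwiseDisjoint_cyl (n : ℕ → ℕ) {ℓ : ℕ} (s : Set ((i : Fin ℓ) → Fin (n i))) :
    s.PairwiseDisjoint (Cyl n) := fun v _ w _ hvw =>
  Set.disjoint_left.2 fun x hv hw =>
    hvw (((mem_cyl_iff_eq n v x).1 hv).symm.trans ((mem_cyl_iff_eq n w x).1 hw))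

theorem mul_measure_cylHull_le (n : ℕ → ℕ) (μ : Measure (∀ k : ℕ, Fin (n k))) {α : ℝ≥0∞}
    {A M : Set (∀ k : ℕ, Fin (n k))} (hM : MeasurableSet M) {ℓ : ℕ}
    (h : ∀ w : (i : Fin ℓ) → Fin (n i), (A ∩ Cyl n w).Nonempty →
      α * μ (Cyl n w) ≤ μ (Cyl n w ∩ M)) :
    α * μ (cylHull n A ℓ) ≤ μ (cylHull n A ℓ ∩ M) := by
  have hc : {w : (i : Fin ℓ) → Fin (n i) | (A ∩ Cyl n w).Nonempty}.Countable :=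
    Set.to_countable _
  rw [cylHull, Set.iUnion₂_inter,
    measure_biUnion hc (pairwiseDisjoint_cyl n _) fun w _ => (isOpen_cyl n w).measurableSet,
    measure_biUnion hc
      ((pairwiseDisjoint_cyl n _).mono fun w => Set.inter_subset_left)
      fun w _ => (isOpen_cyl n w).measurableSet.inter hM,
    ← ENNReal.tsum_mul_left]
  exact ENNReal.tsum_le_tsum fun w => h w w.2

/-- A closed set is null if a fixed proportion of every cylinder meeting it lies in a set
disjoint from it. -/
theorem measure_eq_zero_of_cyl_density (n : ℕ → ℕ) (μ : Measure (∀ k : ℕ, Fin (n k)))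
    [IsFiniteMeasure μ] {α : ℝ≥0∞} (hα : 0 < α) {A M : Set (∀ k : ℕ, Fin (n k))}
    (hA : IsClosed A) (hM : MeasurableSet M) (hAM : Disjoint A M)
    (h : ∀ (ℓ : ℕ) (w : (i : Fin ℓ) → Fin (n i)), (A ∩ Cyl n w).Nonempty →
      α * μ (Cyl n w) ≤ μ (Cyl n w ∩ M)) :
    μ A = 0 := by
  have hlim : Filter.Tendsto (fun ℓ => μ (cylHull n A ℓ)) Filter.atTop (nhds (μ A)) := by
    have := tendsto_measure_iInter_atTop (μ := μ)
      (fun ℓ => (isOpen_cylHull n A ℓ).measurableSet.nullMeasurableSet)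
      (antitone_cylHull n A) ⟨0, measure_ne_top μ _⟩
    rwa [iInter_cylHull n hA] at this
  have hle : μ A + α * μ A ≤ μ A := by
    refine ge_of_tendsto' hlim fun ℓ => ?_
    calc μ A + α * μ A ≤ μ A + μ (cylHull n A ℓ ∩ M) := by
          gcongr
          refine le_trans ?_ (mul_measure_cylHull_le n μ hM (h ℓ))
          gcongr
          exact subset_cylHull n A ℓ
      _ = μ (A ∪ cylHull n A ℓ ∩ M) :=
          (measure_union (hAM.mono_right Set.inter_subset_right)
            ((isOpen_cylHull n A ℓ).measurableSet.inter hM)).symm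
      _ ≤ μ (cylHull n A ℓ) :=
          measure_mono (Set.union_subset (subset_cylHull n A ℓ) Set.inter_subset_left)
  have hzero : α * μ A ≤ 0 :=
    (ENNReal.add_le_add_iff_left (measure_ne_top μ A)).1 (by simpa using hle)
  exact (mul_eq_zero.1 (le_antisymm hzero bot_le)).resolve_left hα.ne'

theorem IsTreeAut.isOpen_ne {n : ℕ → ℕ} {f : (∀ k : ℕ, Fin (n k)) → ∀ k : ℕ, Fin (n k)}
    (hf : IsTreeAut n f) : IsOpen {x | f x ≠ x} := by
  refine isOpen_iff_forall_mem_open.2 fun x hx => ?_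
  obtain ⟨k, hk⟩ := Function.ne_iff.1 hx
  refine ⟨Cyl n (fun i : Fin (k + 1) => x i), fun y hy hfy => hk ?_, isOpen_cyl n _,
    mem_cyl_self n _ x⟩
  have h := (hf.2 (k + 1) y x).1 hy ⟨k, k.lt_succ_self⟩
  have h' := hy ⟨k, k.lt_succ_self⟩
  rw [hfy] at h
  exact h.symm.trans h'

theorem IsTreeAut.image_cyl {n : ℕ → ℕ} {f : (∀ k : ℕ, Fin (n k)) → ∀ k : ℕ, Fin (n k)}
    (hf : IsTreeAut n f) {ℓ : ℕ} {w : (i : Fin ℓ) → Fin (n i)} {x : ∀ k : ℕ, Fin (n k)}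
    (hxw : x ∈ Cyl n w) (hx : f x = x) : f '' Cyl n w = Cyl n w := by
  have key : ∀ y, y ∈ Cyl n w ↔ f y ∈ Cyl n w := fun y => by
    obtain rfl := (mem_cyl_iff_eq n w x).1 hxw
    have h := hf.2 ℓ y x
    rwa [hx] at h
  ext z
  constructor
  · rintro ⟨y, hy, rfl⟩
    exact (key y).1 hy
  · intro hz
    obtain ⟨y, rfl⟩ := hf.1.2 z
    exact ⟨y, (key y).2 hz, rfl⟩

/-- The boundary of the fixed point set of a locally non-degenerate tree automorphism is
null. -/
theorem LocNonDeg.measure_fixed_diff_interior {n : ℕ → ℕ} {μ : Measure (∀ k : ℕ, Fin (n k))}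
    [IsFiniteMeasure μ] {f : (∀ k : ℕ, Fin (n k)) → ∀ k : ℕ, Fin (n k)}
    (hnd : LocNonDeg n μ f) (hf : IsTreeAut n f) :
    μ ({x | f x = x} \ interior {x | f x = x}) = 0 := by
  obtain ⟨α, hα, -, h⟩ := hnd
  have hclosed : IsClosed {x | f x = x} := ⟨hf.isOpen_ne⟩
  refine measure_eq_zero_of_cyl_density n μ hα (M := {x | f x ≠ x})
    (hclosed.sdiff isOpen_interior) hf.isOpen_ne.measurableSet
    (Set.disjoint_left.2 fun x hx hx' => hx' hx.1) ?_
  rintro ℓ w ⟨x, ⟨hx, hxi⟩, hxw⟩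
  refine h ℓ w (hf.image_cyl hxw hx) ?_
  by_contra! hc
  exact hxi (mem_interior.2 ⟨Cyl n w, hc, isOpen_cyl n w, hxw⟩)

/-- If a countable group acts minimally on the path space by locally
non-degenerate tree automorphisms, then the set of points with non-trivial holonomy is
null; equivalently, the set of points without holonomy has full measure. -/
theorem statement6 (n : ℕ → ℕ) (hn : ∀ ℓ : ℕ, 2 ≤ n ℓ)
    (μ : Measure (∀ k : ℕ, Fin (n k))) [IsProbabilityMeasure μ]
    (hμ : ∀ (ℓ : ℕ) (w : (i : Fin ℓ) → Fin (n i)),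
      μ (Cyl n w) = ∏ i : Fin ℓ, ((n i : ℝ≥0∞))⁻¹)
    {G : Type*} [Group G] [Countable G] [MulAction G (∀ k : ℕ, Fin (n k))]
    (htree : ∀ g : G, IsTreeAut n (fun x => g • x))
    (hmin : ∀ x : ∀ k : ℕ, Fin (n k), Dense (MulAction.orbit G x))
    (hnd : ∀ g : G, LocNonDeg n μ (fun x => g • x)) :
    μ {x : ∀ k : ℕ, Fin (n k) |
        ¬ ∀ g : G, g • x = x →
          ∃ U : Set (∀ k : ℕ, Fin (n k)), IsOpen U ∧ x ∈ U ∧ ∀ y ∈ U, g • y = y} = 0 := by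
  have hnull : μ (⋃ g : G, {x : ∀ k : ℕ, Fin (n k) | g • x = x} \
      interior {x : ∀ k : ℕ, Fin (n k) | g • x = x}) = 0 :=
    measure_iUnion_null fun g => (hnd g).measure_fixed_diff_interior (htree g)
  refine measure_mono_null (fun x hx => ?_) hnull
  rw [Set.mem_ofPred_eq] at hx
  push Not at hx
  obtain ⟨g, hg, hU⟩ := hx
  refine Set.mem_iUnion.2 ⟨g, hg, fun hi => ?_⟩
  obtain ⟨y, hy, hgy⟩ := hU _ isOpen_interior hi
  have hy' : y ∈ {x : ∀ k : ℕ, Fin (n k) | g • x = x} := interior_subset hy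
  exact hgy hy'
end

section
/- Let n : ℕ → ℕ with n(ℓ) ≥ 2 for all ℓ, let X = Π_{ℓ∈ℕ} Fin(n(ℓ)) be the path space with product measure μ, and let G be a countable group acting minimally on X by tree automorphisms, with every element of G acting as a locally non-degenerate tree automorphism. If the action is topologically free, i.e. the set {x ∈ X : g·x = x for some g ≠ 1} is meager in X, then the action is essentially free, i.e. μ({x ∈ X : g·x = x for some g ≠ 1}) = 0. -/
open MeasureTheory ENNReal

theorem cyl_eq_iInter (n : ℕ → ℕ) {ℓ : ℕ} (w : (i : Fin ℓ) → Fin (n i)) :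
    Cyl n w = ⋂ i : Fin ℓ, (fun x : ∀ k : ℕ, Fin (n k) => x i) ⁻¹' {w i} := by
  ext x
  simp [Cyl]

theorem measurableSet_cyl (n : ℕ → ℕ) {ℓ : ℕ} (w : (i : Fin ℓ) → Fin (n i)) :
    MeasurableSet (Cyl n w) := by
  rw [cyl_eq_iInter]
  exact MeasurableSet.iInter fun i => measurable_pi_apply (i : ℕ) (measurableSet_singleton _)

open MeasureTheory Filter Topology in
theorem measure_fixedPoints_eq_zero (n : ℕ → ℕ) (μ : Measure (∀ k : ℕ, Fin (n k)))
    [IsFiniteMeasure μ] {f : (∀ k : ℕ, Fin (n k)) → ∀ k : ℕ, Fin (n k)}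
    (hf : IsTreeAut n f) (hnd : LocNonDeg n μ f)
    (hmov : ∀ (ℓ : ℕ) (w : (i : Fin ℓ) → Fin (n i)), (Cyl n w).Nonempty →
      ∃ u ∈ Cyl n w, f u ≠ u) :
    μ {x | f x = x} = 0 := by
  obtain ⟨α, hα, -, hnd⟩ := hnd
  set A : ℕ → Set (∀ k : ℕ, Fin (n k)) := fun ℓ => {x | ∀ i : Fin ℓ, f x i = x i} with hA
  have hfix : {x | f x = x} = ⋂ ℓ, A ℓ := by
    ext x
    simp only [hA, Set.mem_ofPred_eq, Set.mem_iInter]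
    exact ⟨fun h ℓ i => by rw [h], fun h => funext fun k => h (k + 1) ⟨k, k.lt_succ_self⟩⟩
  have hcyl : ∀ (ℓ : ℕ) (w : (i : Fin ℓ) → Fin (n i)), MeasurableSet (Cyl n w) := fun ℓ w =>
    measurableSet_cyl n w
  let S : ∀ ℓ : ℕ, Finset ((i : Fin ℓ) → Fin (n i)) := fun ℓ =>
    (Set.toFinite {w | ∃ x ∈ A ℓ, x ∈ Cyl n w}).toFinset
  have hmem : ∀ ℓ w, w ∈ S ℓ ↔ ∃ x ∈ A ℓ, x ∈ Cyl n w := fun ℓ w => by simp [S]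
  have hsub : ∀ ℓ, ∀ w ∈ S ℓ, Cyl n w ⊆ A ℓ := by
    intro ℓ w hw y hy
    obtain ⟨x, hx, hxw⟩ := (hmem ℓ w).1 hw
    intro i
    have := (hf.2 ℓ x y).1 (fun i => (hxw i).trans (hy i).symm) i
    rw [← this, hx i, hxw i, hy i]
  have hAeq : ∀ ℓ, A ℓ = ⋃ w ∈ S ℓ, Cyl n w := by
    intro ℓ
    refine Set.Subset.antisymm (fun x hx => ?_) (Set.iUnion₂_subset (hsub ℓ))
    exact Set.mem_biUnion (x := fun i : Fin ℓ => x i)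
      ((hmem ℓ _).2 ⟨x, hx, fun _ => rfl⟩) (fun _ => rfl)
  have hAm : ∀ ℓ, MeasurableSet (A ℓ) := fun ℓ => by
    rw [hAeq]; exact (S ℓ).measurableSet_biUnion fun w _ => hcyl ℓ w
  have hFm : MeasurableSet {x | f x = x} := by
    rw [hfix]; exact MeasurableSet.iInter hAm
  have hFA : ∀ ℓ, {x | f x = x} ⊆ A ℓ := fun ℓ => hfix ▸ Set.iInter_subset A ℓ
  have himg : ∀ ℓ, ∀ w ∈ S ℓ, f '' Cyl n w = Cyl n w := by
    intro ℓ w hw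
    obtain ⟨x, hx, hxw⟩ := (hmem ℓ w).1 hw
    apply Set.Subset.antisymm
    · rintro _ ⟨y, hy, rfl⟩ i
      rw [hsub ℓ w hw hy i, hy i]
    · intro y hy
      obtain ⟨z, rfl⟩ := hf.1.2 y
      refine ⟨z, fun i => ?_, rfl⟩
      rw [(hf.2 ℓ z x).2 (fun i => by rw [hx i, hxw i, hy i]) i, hxw i]
  have hbound : ∀ ℓ, α * μ (A ℓ) ≤ μ (A ℓ \ {x | f x = x}) := by
    intro ℓ
    calc α * μ (A ℓ) ≤ α * ∑ w ∈ S ℓ, μ (Cyl n w) := by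
          gcongr
          rw [hAeq]
          exact measure_biUnion_finset_le _ _
      _ = ∑ w ∈ S ℓ, α * μ (Cyl n w) := Finset.mul_sum _ _ _
      _ ≤ ∑ w ∈ S ℓ, μ (Cyl n w \ {x | f x = x}) := by
          refine Finset.sum_le_sum fun w hw => hnd ℓ w (himg ℓ w hw) (hmov ℓ w ?_)
          obtain ⟨x, -, hxw⟩ := (hmem ℓ w).1 hw
          exact ⟨x, hxw⟩
      _ = μ (⋃ w ∈ S ℓ, Cyl n w \ {x | f x = x}) := by
          refine (measure_biUnion_finset ?_ fun w _ => (hcyl ℓ w).diff hFm).symm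
          intro v _ w _ hvw
          refine Set.disjoint_left.2 fun x hv hw => hvw (funext fun i => ?_)
          exact (hv.1 i).symm.trans (hw.1 i)
      _ ≤ μ (A ℓ \ {x | f x = x}) := by
          refine measure_mono (Set.iUnion₂_subset fun w hw => ?_)
          exact Set.sdiff_subset_sdiff_left (hsub ℓ w hw)
  have hanti : Antitone fun ℓ => A ℓ \ {x | f x = x} := by
    intro a b hab x hx
    exact ⟨fun i => hx.1 ⟨i, i.2.trans_le hab⟩, hx.2⟩
  have hlim : Tendsto (fun ℓ => μ (A ℓ \ {x | f x = x})) atTop (𝓝 0) := by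
    have h := tendsto_measure_iInter_atTop (μ := μ)
      (fun ℓ => ((hAm ℓ).diff hFm).nullMeasurableSet) hanti ⟨0, measure_ne_top _ _⟩
    have he : ⋂ ℓ, A ℓ \ {x | f x = x} = ∅ := by
      rw [Set.eq_empty_iff_forall_notMem]
      intro x hx
      have hx := Set.mem_iInter.1 hx
      exact (hx 0).2 (hfix ▸ Set.mem_iInter.2 fun ℓ => (hx ℓ).1)
    rwa [he, measure_empty] at h
  have hle : α * μ {x | f x = x} ≤ 0 := ge_of_tendsto' hlim fun ℓ =>
    (mul_le_mul_right (measure_mono (hFA ℓ)) α).trans (hbound ℓ)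
  exact (mul_eq_zero.1 (nonpos_iff_eq_zero.1 hle)).resolve_left hα.ne'

/-- If a countable group acts minimally on the path space by locally
non-degenerate tree automorphisms and the action is topologically free, then it is
essentially free. -/
theorem statement7 (n : ℕ → ℕ) (hn : ∀ ℓ : ℕ, 2 ≤ n ℓ)
    (μ : Measure (∀ k : ℕ, Fin (n k))) [IsProbabilityMeasure μ]
    (hμ : ∀ (ℓ : ℕ) (w : (i : Fin ℓ) → Fin (n i)),
      μ (Cyl n w) = ∏ i : Fin ℓ, ((n i : ℝ≥0∞))⁻¹)
    {G : Type*} [Group G] [Countable G] [MulAction G (∀ k : ℕ, Fin (n k))]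
    (htree : ∀ g : G, IsTreeAut n (fun x => g • x))
    (hmin : ∀ x : ∀ k : ℕ, Fin (n k), Dense (MulAction.orbit G x))
    (hnd : ∀ g : G, LocNonDeg n μ (fun x => g • x))
    (htf : IsMeagre {x : ∀ k : ℕ, Fin (n k) | ∃ g : G, g ≠ 1 ∧ g • x = x}) :
    μ {x : ∀ k : ℕ, Fin (n k) | ∃ g : G, g ≠ 1 ∧ g • x = x} = 0 := by
  have hset : {x : ∀ k : ℕ, Fin (n k) | ∃ g : G, g ≠ 1 ∧ g • x = x} =
      ⋃ g : {g : G // g ≠ 1}, {x | (g : G) • x = x} := by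
    ext x
    simp
  rw [hset, measure_iUnion_null_iff]
  rintro ⟨g, hg⟩
  refine measure_fixedPoints_eq_zero n μ (htree g) (hnd g) fun ℓ w hw => ?_
  by_contra! h
  exact not_isMeagre_of_isOpen (isOpen_cyl n w) hw <|
    htf.mono (show Cyl n w ⊆ {x | ∃ g : G, g ≠ 1 ∧ g • x = x} from fun x hx => ⟨g, hg, h x hx⟩)
end

section
/- Let n : ℕ → ℕ with n(ℓ) ≥ 2 for all ℓ, let X = Π_{ℓ∈ℕ} Fin(n(ℓ)) be the path space with product measure μ, and let g be a tree automorphism of X. Suppose: (1) there is M > 0 with n(ℓ) ≤ M for all ℓ; and (2) there is K ∈ ℕ such that for every finite word v of length ℓ with g(C_v) = C_v and g not equal to the identity on C_v, there exist m with ℓ ≤ m ≤ ℓ + K and a finite word w of length m extending v such that g(C_w) ≠ C_w. Then g is locally non-degenerate; indeed one may take α = M^{-K}. -/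
open MeasureTheory ENNReal

/-- A tree automorphism maps the cylinder around a fixed point onto itself. -/
theorem IsTreeAut.image_cyl_eq_of_fixed {n : ℕ → ℕ}
    {f : (∀ k : ℕ, Fin (n k)) → ∀ k : ℕ, Fin (n k)} (hf : IsTreeAut n f)
    {m : ℕ} {w : (i : Fin m) → Fin (n i)} {u : ∀ k : ℕ, Fin (n k)}
    (hu : u ∈ Cyl n w) (hfu : f u = u) : f '' Cyl n w = Cyl n w := by
  have key : ∀ x, x ∈ Cyl n w ↔ f x ∈ Cyl n w := fun x => by
    have h := hf.2 m x u
    have hw : ∀ i : Fin m, u i = w i := hu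
    simp only [hfu, hw] at h
    exact h
  ext y
  constructor
  · rintro ⟨x, hx, rfl⟩
    exact (key x).1 hx
  · intro hy
    obtain ⟨x, rfl⟩ := hf.1.2 y
    exact ⟨x, (key x).2 hy, rfl⟩

/-- Passing `d` levels down divides the product of the inverse indices by at most `M ^ d`. -/
theorem inv_pow_mul_prod_range_le {n : ℕ → ℕ} {M : ℕ} (hMb : ∀ ℓ, n ℓ ≤ M) (ℓ d : ℕ) :
    ((M : ℝ≥0∞)⁻¹) ^ d * ∏ i ∈ Finset.range ℓ, ((n i : ℝ≥0∞))⁻¹ ≤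
      ∏ i ∈ Finset.range (ℓ + d), ((n i : ℝ≥0∞))⁻¹ := by
  have h : ((M : ℝ≥0∞)⁻¹) ^ d ≤ ∏ i ∈ Finset.range d, ((n (ℓ + i) : ℝ≥0∞))⁻¹ := by
    calc ((M : ℝ≥0∞)⁻¹) ^ d = ∏ _i ∈ Finset.range d, (M : ℝ≥0∞)⁻¹ := by simp
      _ ≤ _ := Finset.prod_le_prod' fun i _ =>
        ENNReal.inv_le_inv.2 (by exact_mod_cast hMb (ℓ + i))
  rw [Finset.prod_range_add, mul_comm]
  gcongr

/-- If the spherical index is bounded by `M` and every setwise-fixed,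
not pointwise-fixed cylinder contains, within `K` further levels, a subcylinder that is not
fixed setwise, then the tree automorphism is locally non-degenerate, with `α = M^{-K}`. -/
theorem statement9 (n : ℕ → ℕ) (hn : ∀ ℓ : ℕ, 2 ≤ n ℓ)
    (μ : Measure (∀ k : ℕ, Fin (n k))) [IsProbabilityMeasure μ]
    (hμ : ∀ (ℓ : ℕ) (w : (i : Fin ℓ) → Fin (n i)),
      μ (Cyl n w) = ∏ i : Fin ℓ, ((n i : ℝ≥0∞))⁻¹)
    (f : (∀ k : ℕ, Fin (n k)) → ∀ k : ℕ, Fin (n k)) (hf : IsTreeAut n f)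
    (M : ℕ) (hM : 0 < M) (hMb : ∀ ℓ : ℕ, n ℓ ≤ M)
    (K : ℕ)
    (hK : ∀ (ℓ : ℕ) (v : (i : Fin ℓ) → Fin (n i)),
      f '' Cyl n v = Cyl n v → (∃ u ∈ Cyl n v, f u ≠ u) →
      ∃ (m : ℕ) (hm : ℓ ≤ m), m ≤ ℓ + K ∧
        ∃ w : (i : Fin m) → Fin (n i),
          (∀ i : Fin ℓ, w (Fin.castLE hm i) = v i) ∧ f '' Cyl n w ≠ Cyl n w) :
    (∀ (ℓ : ℕ) (w : (i : Fin ℓ) → Fin (n i)),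
      f '' Cyl n w = Cyl n w → (∃ u ∈ Cyl n w, f u ≠ u) →
        ((M : ℝ≥0∞) ^ K)⁻¹ * μ (Cyl n w) ≤ μ {u ∈ Cyl n w | f u ≠ u}) ∧
    LocNonDeg n μ f := by
  have hM1 : (M : ℝ≥0∞)⁻¹ ≤ 1 := ENNReal.inv_le_one.2 (by exact_mod_cast hM)
  have main : ∀ (ℓ : ℕ) (w : (i : Fin ℓ) → Fin (n i)),
      f '' Cyl n w = Cyl n w → (∃ u ∈ Cyl n w, f u ≠ u) →
        ((M : ℝ≥0∞) ^ K)⁻¹ * μ (Cyl n w) ≤ μ {u ∈ Cyl n w | f u ≠ u} := by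
    intro ℓ v hv hne
    obtain ⟨m, hm, hmK, w, hwv, hw⟩ := hK ℓ v hv hne
    have hsub : Cyl n w ⊆ {u ∈ Cyl n v | f u ≠ u} := fun u hu =>
      ⟨fun i => (hu (Fin.castLE hm i)).trans (hwv i),
        fun hfu => hw (hf.image_cyl_eq_of_fixed hu hfu)⟩
    refine le_trans ?_ (measure_mono hsub)
    obtain ⟨d, rfl⟩ := Nat.exists_eq_add_of_le hm
    rw [hμ, hμ, Fin.prod_univ_eq_prod_range (fun i => ((n i : ℝ≥0∞))⁻¹) ℓ,
      Fin.prod_univ_eq_prod_range (fun i => ((n i : ℝ≥0∞))⁻¹) (ℓ + d), ENNReal.inv_pow]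
    refine le_trans ?_ (inv_pow_mul_prod_range_le hMb ℓ d)
    gcongr ?_ * _
    exact pow_le_pow_right_of_le_one' hM1 (by omega)
  refine ⟨main, ((M : ℝ≥0∞) ^ K)⁻¹, ?_, ?_, main⟩
  · exact ENNReal.inv_pos.2 (ENNReal.pow_ne_top (ENNReal.natCast_ne_top M))
  · rw [ENNReal.inv_pow]
    exact pow_le_one' hM1 K
end

section
/- Let d ≥ 2, let X = ℕ → Fin(d) with the product topology and the uniform product (Bernoulli) measure μ, and let g be a tree automorphism of X. If the set of sections {g|_w : w a finite word over Fin(d)} is finite, then g is locally non-degenerate. -/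
open MeasureTheory ENNReal

/-- The cylinder in `ℕ → Fin d` determined by a finite word `w : List (Fin d)`. -/
def CylL (d : ℕ) (w : List (Fin d)) : Set (ℕ → Fin d) :=
  {x | ∀ (k : ℕ) (h : k < w.length), x k = w.get ⟨k, h⟩}

/-- Concatenation of a finite word with an infinite sequence. -/
def concatW (d : ℕ) (w : List (Fin d)) (s : ℕ → Fin d) : ℕ → Fin d :=
  fun k => if h : k < w.length then w.get ⟨k, h⟩ else s (k - w.length)

/-- A tree automorphism of `ℕ → Fin d`: a bijection such that two sequences agree in the
first `ℓ` coordinates iff their images do. -/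
def IsTreeAutD (d : ℕ) (f : (ℕ → Fin d) → ℕ → Fin d) : Prop :=
  Function.Bijective f ∧ ∀ (ℓ : ℕ) (x y : ℕ → Fin d),
    (∀ k < ℓ, x k = y k) ↔ (∀ k < ℓ, f x k = f y k)

/-- `h` is the section of `f` at the word `w`: there is a word `w'` of the same length with
`f (w · s) = w' · (h s)` for all sequences `s`. -/
def IsSectionAt (d : ℕ) (f : (ℕ → Fin d) → ℕ → Fin d) (w : List (Fin d))
    (h : (ℕ → Fin d) → ℕ → Fin d) : Prop :=
  ∃ w' : List (Fin d), w'.length = w.length ∧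
    ∀ s : ℕ → Fin d, f (concatW d w s) = concatW d w' (h s)

/-- A tree automorphism is locally non-degenerate. -/
def LocNonDegD (d : ℕ) (μ : Measure (ℕ → Fin d)) (f : (ℕ → Fin d) → ℕ → Fin d) : Prop :=
  ∃ α : ℝ≥0∞, 0 < α ∧ α ≤ 1 ∧ ∀ w : List (Fin d),
    f '' CylL d w = CylL d w → (∃ u ∈ CylL d w, f u ≠ u) →
      α * μ (CylL d w) ≤ μ {u ∈ CylL d w | f u ≠ u}

lemma mem_CylL_ofFn {d m : ℕ} {x y : ℕ → Fin d} :
    x ∈ CylL d (List.ofFn fun i : Fin m => y i) ↔ ∀ k < m, x k = y k := by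
  simp [CylL]

lemma concatW_mem_CylL {d : ℕ} (w : List (Fin d)) (s : ℕ → Fin d) :
    concatW d w s ∈ CylL d w := fun k h => by simp [concatW, h]

lemma concatW_add_length {d : ℕ} (w : List (Fin d)) (s : ℕ → Fin d) (k : ℕ) :
    concatW d w s (k + w.length) = s k := by
  simp [concatW]

lemma concatW_tail_of_mem_CylL {d : ℕ} {w : List (Fin d)} {x : ℕ → Fin d} (hx : x ∈ CylL d w) :
    concatW d w (fun k => x (k + w.length)) = x := by
  funext k
  by_cases h : k < w.length
  · simpa [concatW, h] using (hx k h).symm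
  · simp [concatW, h, Nat.sub_add_cancel (not_lt.mp h)]

/-- A finite set of self-maps of the path space admits a common depth at which each
non-identity member visibly moves some sequence. -/
lemma exists_uniform_moving_depth {d : ℕ} {S : Set ((ℕ → Fin d) → ℕ → Fin d)} (hS : S.Finite) :
    ∃ N : ℕ, ∀ h ∈ S, (∃ v, h v ≠ v) → ∃ v, ∃ k < N, h v k ≠ v k := by
  have hex : ∀ h : (ℕ → Fin d) → ℕ → Fin d, ∃ n : ℕ,
      (∃ v, h v ≠ v) → ∃ v, ∃ k < n, h v k ≠ v k := by
    intro h
    by_cases hv : ∃ v, h v ≠ v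
    · obtain ⟨v, hv⟩ := hv
      obtain ⟨k, hk⟩ := Function.ne_iff.mp hv
      exact ⟨k + 1, fun _ => ⟨v, k, k.lt_succ_self, hk⟩⟩
    · exact ⟨0, fun h' => absurd h' hv⟩
  choose n hn using hex
  obtain ⟨N, hN⟩ := (hS.image n).bddAbove
  refine ⟨N, fun h hh hne => ?_⟩
  obtain ⟨v, k, hk, hvk⟩ := hn h hne
  exact ⟨v, k, hk.trans_le (hN ⟨h, hh, rfl⟩), hvk⟩

/-- A tree automorphism of the `d`-ary path space with finitely many sections
(i.e. computable by a finite automaton) is locally non-degenerate. -/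
theorem statement10 (d : ℕ) (hd : 2 ≤ d)
    (μ : Measure (ℕ → Fin d)) [IsProbabilityMeasure μ]
    (hμ : ∀ w : List (Fin d), μ (CylL d w) = ((d : ℝ≥0∞))⁻¹ ^ w.length)
    (f : (ℕ → Fin d) → ℕ → Fin d) (hf : IsTreeAutD d f)
    (hfin : ({h : (ℕ → Fin d) → ℕ → Fin d | ∃ w : List (Fin d), IsSectionAt d f w h}).Finite) :
    LocNonDegD d μ f := by
  obtain ⟨N, hN⟩ := exists_uniform_moving_depth hfin
  have hd1 : ((d : ℝ≥0∞))⁻¹ ≤ 1 := by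
    rw [ENNReal.inv_le_one]
    exact_mod_cast (by omega : 1 ≤ d)
  refine ⟨((d : ℝ≥0∞))⁻¹ ^ N, ENNReal.pow_pos (by simp) N, pow_le_one₀ zero_le hd1, ?_⟩
  rintro w hw ⟨u, hu, hne⟩
  set g : (ℕ → Fin d) → ℕ → Fin d := fun s k => f (concatW d w s) (k + w.length) with hg
  have hfw : ∀ s, f (concatW d w s) = concatW d w (g s) := fun s =>
    (concatW_tail_of_mem_CylL (hw ▸ Set.mem_image_of_mem f (concatW_mem_CylL w s))).symm
  have hgne : ∃ v, g v ≠ v := by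
    refine ⟨fun k => u (k + w.length), fun h => hne ?_⟩
    have hfu := hfw fun k => u (k + w.length)
    rwa [h, concatW_tail_of_mem_CylL hu] at hfu
  obtain ⟨v, k, hk, hvk⟩ := hN g ⟨w, w, rfl, hfw⟩ hgne
  have hsub : CylL d (List.ofFn fun i : Fin (k + w.length + 1) => concatW d w v i) ⊆
      {u ∈ CylL d w | f u ≠ u} := by
    intro x hx
    rw [mem_CylL_ofFn] at hx
    refine ⟨fun i hi => (hx i (by omega)).trans (concatW_mem_CylL w v i hi), fun hfx => hvk ?_⟩
    have hfxv := (hf.2 _ _ _).mp hx (k + w.length) (by omega)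
    rw [hfx, hx _ (by omega), concatW_add_length] at hfxv
    exact hfxv.symm
  refine le_trans ?_ (measure_mono hsub)
  rw [hμ, hμ, ← pow_add, List.length_ofFn]
  exact pow_le_pow_of_le_one zero_le hd1 (by omega)
end

section
/- Let n : ℕ → ℕ satisfy n(0) ≥ 3 and n(ℓ+1) > 2·n(ℓ) for all ℓ, and let X = Π_{ℓ∈ℕ} Fin(n(ℓ)) be the path space with product measure μ. Then there exists a tree automorphism b of X such that: (i) b is not equal to the identity on any nonempty open subset of X; (ii) the fixed-point set Fix(b) = {x ∈ X : b(x) = x} is nonempty and μ(Fix(b)) > 0; and (iii) for every x ∈ Fix(b), the Lebesgue density of Fix(b) at x along cylinders equals 1, i.e. μ(Fix(b) ∩ C_{x|ℓ}) / μ(C_{x|ℓ}) → 1 as ℓ → ∞, where x|ℓ denotes the length-ℓ prefix of x. -/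
open MeasureTheory ENNReal Filter

/-- The digit transposition exchanging `0` and `1` in every coordinate. -/
def digitSwap (n : ℕ → ℕ) (h : ∀ k, 2 < n k) (k : ℕ) : Equiv.Perm (Fin (n k)) :=
  Equiv.swap ⟨0, by have := h k; omega⟩ ⟨1, by have := h k; omega⟩

theorem digitSwap_eq_self_iff (n : ℕ → ℕ) (h : ∀ k, 2 < n k) (k : ℕ) (a : Fin (n k)) :
    digitSwap n h k a = a ↔ 2 ≤ (a : ℕ) := by
  unfold digitSwap
  rw [Equiv.swap_apply_def]
  split_ifs with h0 h1
  · subst h0; simp [Fin.ext_iff]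
  · subst h1; simp [Fin.ext_iff]
  · simp only [Fin.ext_iff] at h0 h1
    simp only [true_iff]
    omega

/-- A coordinatewise family of permutations is a tree automorphism. -/
theorem isTreeAut_piMap (n : ℕ → ℕ) (σ : ∀ k, Equiv.Perm (Fin (n k))) :
    IsTreeAut n (fun x k => σ k (x k)) := by
  refine ⟨(Equiv.piCongrRight σ).bijective, fun ℓ x y => ?_⟩
  simp

/-- A cylinder of length at most `k` is independent of the `k`-th coordinate (upper bound). -/
theorem measure_cyl_inter_coord_le (n : ℕ → ℕ) (μ : Measure (∀ k : ℕ, Fin (n k)))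
    (hμ : ∀ (ℓ : ℕ) (w : (i : Fin ℓ) → Fin (n i)),
      μ (Cyl n w) = ∏ i : Fin ℓ, ((n i : ℝ≥0∞))⁻¹)
    {ℓ k : ℕ} (hk : ℓ ≤ k) (x : ∀ k : ℕ, Fin (n k)) (j : Fin (n k)) :
    μ (Cyl n (fun i : Fin ℓ => x i) ∩ {y | y k = j}) ≤
      μ (Cyl n (fun i : Fin ℓ => x i)) * (n k : ℝ≥0∞)⁻¹ := by
  classical
  let res : (∀ k : ℕ, Fin (n k)) → ((i : Fin k) → Fin (n i)) := fun y i => y i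
  let S : Finset ((i : Fin k) → Fin (n i)) :=
    Finset.univ.filter fun w => ∀ i : Fin ℓ, w (Fin.castLE hk i) = x i
  have hres (w : (i : Fin k) → Fin (n i)) : res ⁻¹' {w} = Cyl n w := by
    ext y
    simp [res, Cyl, funext_iff]
  have hmeas : Measurable res := by fun_prop
  have hC : Cyl n (fun i : Fin ℓ => x i) = res ⁻¹' S := by
    ext y
    simp [res, S, Cyl]
  have hext (w : (i : Fin k) → Fin (n i)) :
      μ (Cyl n w ∩ {y | y k = j}) = μ (Cyl n w) * (n k : ℝ≥0∞)⁻¹ := by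
    have h : Cyl n w ∩ {y | y k = j} =
        Cyl n (ℓ := k + 1) (Fin.snoc (α := fun i : Fin (k + 1) => Fin (n i)) w j) := by
      ext y
      simp [Cyl, Fin.forall_fin_succ']
    rw [h, hμ, hμ, Fin.prod_univ_castSucc]
    simp
  calc μ (Cyl n (fun i : Fin ℓ => x i) ∩ {y | y k = j})
      ≤ μ (⋃ w ∈ S, Cyl n w ∩ {y | y k = j}) := by
        refine measure_mono fun y hy => ?_
        simp only [Set.mem_iUnion]
        refine ⟨res y, ?_, fun _ => rfl, hy.2⟩
        rw [hC] at hy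
        exact hy.1
    _ ≤ ∑ w ∈ S, μ (Cyl n w ∩ {y | y k = j}) := measure_biUnion_finset_le _ _
    _ = (∑ w ∈ S, μ (res ⁻¹' {w})) * (n k : ℝ≥0∞)⁻¹ := by
        simp only [hext, hres, Finset.sum_mul]
    _ = _ := by
        rw [sum_measure_preimage_singleton S fun w _ => hmeas (measurableSet_singleton w), hC]

/-- Within a cylinder around a path with no digit below `2`, the paths having some digit below `2`
occupy a proportion at most `4 / n ℓ`. -/
theorem measure_cyl_le_add (n : ℕ → ℕ) (h2 : ∀ k, 2 < n k) (hn : ∀ ℓ : ℕ, 2 * n ℓ < n (ℓ + 1))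
    (μ : Measure (∀ k : ℕ, Fin (n k)))
    (hμ : ∀ (ℓ : ℕ) (w : (i : Fin ℓ) → Fin (n i)),
      μ (Cyl n w) = ∏ i : Fin ℓ, ((n i : ℝ≥0∞))⁻¹)
    (x : ∀ k : ℕ, Fin (n k)) (hx : ∀ k, 2 ≤ (x k : ℕ)) (ℓ : ℕ) :
    μ (Cyl n (fun i : Fin ℓ => x i)) ≤
      μ ({y | ∀ k, 2 ≤ (y k : ℕ)} ∩ Cyl n (fun i : Fin ℓ => x i)) +
        μ (Cyl n (fun i : Fin ℓ => x i)) * (4 * (n ℓ : ℝ≥0∞)⁻¹) := by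
  set C := Cyl n (fun i : Fin ℓ => x i)
  let F : Set (∀ k : ℕ, Fin (n k)) := {y | ∀ k, 2 ≤ (y k : ℕ)}
  let z (k : ℕ) : Fin (n k) := ⟨0, by have := h2 k; omega⟩
  let o (k : ℕ) : Fin (n k) := ⟨1, by have := h2 k; omega⟩
  let B (m : ℕ) : Set (∀ k : ℕ, Fin (n k)) :=
    (C ∩ {y | y (ℓ + m) = z (ℓ + m)}) ∪ (C ∩ {y | y (ℓ + m) = o (ℓ + m)})
  have hgrow (m : ℕ) : 2 ^ m * n ℓ ≤ n (ℓ + m) := by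
    induction m with
    | zero => simp
    | succ m ih =>
      have := hn (ℓ + m)
      rw [← add_assoc, pow_succ]
      linarith
  have hB (m : ℕ) : μ (B m) ≤ μ C * (2 * (n ℓ : ℝ≥0∞)⁻¹) * 2⁻¹ ^ m := by
    have hinv : (n (ℓ + m) : ℝ≥0∞)⁻¹ ≤ (n ℓ : ℝ≥0∞)⁻¹ * 2⁻¹ ^ m := by
      rw [← ENNReal.inv_pow, ← ENNReal.mul_inv (by simp) (by simp), ENNReal.inv_le_inv, mul_comm]
      exact_mod_cast hgrow m
    calc μ (B m) ≤ μ C * (n (ℓ + m) : ℝ≥0∞)⁻¹ + μ C * (n (ℓ + m) : ℝ≥0∞)⁻¹ :=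
          (measure_union_le _ _).trans <| add_le_add
            (measure_cyl_inter_coord_le n μ hμ (Nat.le_add_right _ _) x _)
            (measure_cyl_inter_coord_le n μ hμ (Nat.le_add_right _ _) x _)
      _ = μ C * 2 * (n (ℓ + m) : ℝ≥0∞)⁻¹ := by ring
      _ ≤ μ C * 2 * ((n ℓ : ℝ≥0∞)⁻¹ * 2⁻¹ ^ m) := by gcongr
      _ = _ := by ring
  have hcover : C ⊆ (F ∩ C) ∪ ⋃ m, B m := by
    intro y hy
    by_cases hF : y ∈ F
    · exact Or.inl ⟨hF, hy⟩
    · right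
      simp only [F, Set.mem_ofPred_eq, not_forall, not_le] at hF
      obtain ⟨k, hk⟩ := hF
      have hℓk : ℓ ≤ k := by
        by_contra! hlt
        have h := hy ⟨k, hlt⟩
        simp only at h
        have := hx k
        rw [h] at hk
        omega
      obtain ⟨m, rfl⟩ := Nat.exists_eq_add_of_le hℓk
      refine Set.mem_iUnion.2 ⟨m, ?_⟩
      have h01 : (y (ℓ + m) : ℕ) = 0 ∨ (y (ℓ + m) : ℕ) = 1 := by omega
      exact h01.imp (fun h => ⟨hy, Fin.ext h⟩) (fun h => ⟨hy, Fin.ext h⟩)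
  calc μ C ≤ μ (F ∩ C) + μ (⋃ m, B m) := (measure_mono hcover).trans (measure_union_le _ _)
    _ ≤ μ (F ∩ C) + ∑' m, μ C * (2 * (n ℓ : ℝ≥0∞)⁻¹) * 2⁻¹ ^ m := by
        gcongr
        exact (measure_iUnion_le _).trans (ENNReal.tsum_le_tsum hB)
    _ = _ := by
        rw [ENNReal.tsum_mul_left, ENNReal.tsum_geometric, ENNReal.one_sub_inv_two, inv_inv]
        ring

/-- On a path space with spherical index satisfying `n 0 ≥ 3` and
`n (ℓ+1) > 2 n ℓ`, there is a tree automorphism `b` which is not the identity on any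
nonempty open set, whose fixed-point set is nonempty and has positive measure, and whose
fixed-point set has Lebesgue density `1` along cylinders at every fixed point. -/
theorem statement12 (n : ℕ → ℕ) (hn0 : 3 ≤ n 0) (hn : ∀ ℓ : ℕ, 2 * n ℓ < n (ℓ + 1))
    (μ : Measure (∀ k : ℕ, Fin (n k))) [IsProbabilityMeasure μ]
    (hμ : ∀ (ℓ : ℕ) (w : (i : Fin ℓ) → Fin (n i)),
      μ (Cyl n w) = ∏ i : Fin ℓ, ((n i : ℝ≥0∞))⁻¹) :
    ∃ b : (∀ k : ℕ, Fin (n k)) → ∀ k : ℕ, Fin (n k),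
      IsTreeAut n b ∧
      (∀ U : Set (∀ k : ℕ, Fin (n k)), IsOpen U → U.Nonempty → ∃ u ∈ U, b u ≠ u) ∧
      ({x : ∀ k : ℕ, Fin (n k) | b x = x}).Nonempty ∧
      0 < μ {x : ∀ k : ℕ, Fin (n k) | b x = x} ∧
      ∀ x : ∀ k : ℕ, Fin (n k), b x = x →
        Tendsto (fun ℓ : ℕ =>
            μ ({y : ∀ k : ℕ, Fin (n k) | b y = y} ∩ Cyl n (fun i : Fin ℓ => x i)) /
              μ (Cyl n (fun i : Fin ℓ => x i)))
          atTop (nhds 1) := by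
  have hlt (k : ℕ) : k + 2 < n k := by
    induction k with
    | zero => omega
    | succ k ih => have := hn k; omega
  have h2 (k : ℕ) : 2 < n k := by have := hlt k; omega
  let b : (∀ k : ℕ, Fin (n k)) → ∀ k : ℕ, Fin (n k) := fun x k => digitSwap n h2 k (x k)
  have hfix (x : ∀ k : ℕ, Fin (n k)) : b x = x ↔ ∀ k, 2 ≤ (x k : ℕ) := by
    simp only [b, funext_iff, digitSwap_eq_self_iff]
  have hdensity (x : ∀ k : ℕ, Fin (n k)) (hx : b x = x) :
      Tendsto (fun ℓ : ℕ =>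
        μ ({y : ∀ k : ℕ, Fin (n k) | b y = y} ∩ Cyl n (fun i : Fin ℓ => x i)) /
          μ (Cyl n (fun i : Fin ℓ => x i))) atTop (nhds 1) := by
    have hlim : Tendsto (fun ℓ => 1 - 4 * (n ℓ : ℝ≥0∞)⁻¹) atTop (nhds 1) := by
      have hn_top : Tendsto n atTop atTop :=
        tendsto_atTop_mono (fun k => (Nat.le_add_right k 2).trans (hlt k).le) tendsto_id
      have h := ENNReal.Tendsto.const_mul (a := 4)
        (ENNReal.tendsto_inv_nat_nhds_zero.comp hn_top) (Or.inr (by simp))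
      simpa using ENNReal.Tendsto.sub (tendsto_const_nhds (x := (1 : ℝ≥0∞))) h
        (Or.inl one_ne_top)
    refine tendsto_of_tendsto_of_tendsto_of_le_of_le hlim tendsto_const_nhds (fun ℓ => ?_)
      (fun ℓ => ENNReal.div_le_of_le_mul (by
        rw [one_mul]; exact measure_mono Set.inter_subset_right))
    have hle := measure_cyl_le_add n h2 hn μ hμ x ((hfix x).1 hx) ℓ
    have hpos : μ (Cyl n (fun i : Fin ℓ => x i)) ≠ 0 := by
      rw [hμ, Finset.prod_ne_zero_iff]
      simp
    have htop : μ (Cyl n (fun i : Fin ℓ => x i)) ≠ ⊤ := measure_ne_top _ _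
    simp only [hfix]
    rw [tsub_le_iff_right]
    have hdiv := ENNReal.div_le_div_right hle (μ (Cyl n (fun i : Fin ℓ => x i)))
    rwa [ENNReal.add_div, ENNReal.div_self hpos htop,
      mul_comm (μ _) (4 * _), ENNReal.mul_div_cancel_right hpos htop] at hdiv
  obtain ⟨x, hx⟩ : ∃ x, b x = x := ⟨fun k => ⟨2, h2 k⟩, (hfix _).2 fun _ => le_rfl⟩
  refine ⟨b, isTreeAut_piMap n _, fun U hU hne => ?_, ⟨x, hx⟩, ?_, hdensity⟩
  · obtain ⟨u, hu⟩ := hne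
    have hlim : Tendsto (fun k => Function.update u k ⟨0, (Nat.zero_lt_of_lt (h2 k))⟩)
        atTop (nhds u) := by
      refine tendsto_pi_nhds.2 fun i => tendsto_const_nhds.congr' ?_
      filter_upwards [eventually_gt_atTop i] with k hk
      rw [Function.update_of_ne hk.ne]
    obtain ⟨k, hk⟩ := (hlim.eventually (hU.mem_nhds hu)).exists
    refine ⟨_, hk, fun h => ?_⟩
    simpa using (hfix _).1 h k
  · obtain ⟨ℓ, hℓ⟩ := ((hdensity x hx).eventually (lt_mem_nhds zero_lt_one)).exists
    exact (ENNReal.div_pos_iff.1 hℓ).1.bot_lt.trans_le (measure_mono Set.inter_subset_left)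
end

section
/- There exist a Cantor set X, a finitely generated group G acting on X by homeomorphisms with the action minimal and equicontinuous, and a G-invariant Borel probability measure μ on X, such that the set of points with non-trivial holonomy has full μ-measure, i.e. μ(X₀) = 0 where X₀ is the set of points without holonomy. -/
open MeasureTheory Filter Topology

/-- Isometries of a separable ultrametric group preserve every finite translation-invariant
Borel measure. -/
theorem IsometryEquiv.map_eq_of_isAddLeftInvariant {X : Type*} [NormedAddCommGroup X]
    [IsUltrametricDist X] [SecondCountableTopology X] [MeasurableSpace X] [BorelSpace X]
    (μ : Measure X) [IsFiniteMeasure μ] [μ.IsAddLeftInvariant] (e : X ≃ᵢ X) :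
    Measure.map e μ = μ := by
  have he : Measurable e := e.continuous.measurable
  have hball : ∀ (x y : X) (r : ℝ), μ (Metric.ball x r) = μ (Metric.ball y r) := by
    intro x y r
    rw [← measure_preimage_add μ (x - y) (Metric.ball x r)]
    congr 1
    ext z
    simp only [Set.mem_preimage, Metric.mem_ball, dist_eq_norm]
    rw [show x - y + z - x = z - y by abel]
  have hbasis : TopologicalSpace.IsTopologicalBasis
      {s : Set X | ∃ x r, s = Metric.ball x r} := by
    refine TopologicalSpace.isTopologicalBasis_of_isOpen_of_nhds ?_ ?_
    · rintro s ⟨x, r, rfl⟩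
      exact Metric.isOpen_ball
    · intro x u hx hu
      obtain ⟨r, hr, hru⟩ := Metric.isOpen_iff.1 hu x hx
      exact ⟨_, ⟨x, r, rfl⟩, Metric.mem_ball_self hr, hru⟩
  refine ext_of_generate_finite {s : Set X | ∃ x r, s = Metric.ball x r}
    ((BorelSpace.measurable_eq (α := X)).trans hbasis.borel_eq_generateFrom) ?_ ?_ ?_
  · rintro s ⟨x, r, rfl⟩ t ⟨y, r', rfl⟩ hst
    rcases IsUltrametricDist.ball_subset_trichotomy x y (r := r) (s := r') with h | h | h
    · exact ⟨x, r, Set.inter_eq_left.2 h⟩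
    · exact ⟨y, r', Set.inter_eq_right.2 h⟩
    · exact absurd h (Set.not_disjoint_iff_nonempty_inter.2 hst)
  · rintro s ⟨x, r, rfl⟩
    rw [Measure.map_apply he measurableSet_ball, e.preimage_ball]
    exact hball _ _ _
  · rw [Measure.map_apply he MeasurableSet.univ, Set.preimage_univ]

/-- The distance to a nonempty closed set in `ℤ_[p]` is the norm of a `p`-adic integer that
depends only on that distance. -/
theorem PadicInt.exists_lipschitzWith_one_zero_iff {p : ℕ} [Fact p.Prime] {K : Set ℤ_[p]}
    (hK : IsClosed K) (hne : K.Nonempty) :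
    ∃ h : ℤ_[p] → ℤ_[p], LipschitzWith 1 h ∧ ∀ x, h x = 0 ↔ x ∈ K := by
  have hφ : ∀ r : ℝ, ∃ w : ℤ_[p], (∃ z : ℤ_[p], ‖z‖ = r) → ‖w‖ = r := by
    intro r
    by_cases hr : ∃ z : ℤ_[p], ‖z‖ = r
    · exact ⟨hr.choose, fun _ => hr.choose_spec⟩
    · exact ⟨0, fun h => absurd h hr⟩
  choose φ hφ using hφ
  have hnorm : ∀ x, ‖φ (Metric.infDist x K)‖ = Metric.infDist x K := by
    intro x
    obtain ⟨y, -, hxy⟩ := hK.isCompact.exists_infDist_eq_dist hne x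
    exact hφ _ ⟨x - y, by rw [hxy, dist_eq_norm]⟩
  have hlt : ∀ x y, Metric.infDist x K < Metric.infDist y K → Metric.infDist y K ≤ dist x y := by
    intro x y hxy
    obtain ⟨z, hz, hxz⟩ := hK.isCompact.exists_infDist_eq_dist hne x
    have h1 : Metric.infDist y K ≤ max (dist y x) (dist x z) :=
      (Metric.infDist_le_dist_of_mem hz).trans (dist_triangle_max y x z)
    rw [← hxz] at h1
    rcases le_max_iff.1 h1 with h | h
    · rwa [dist_comm x y]
    · exact absurd h hxy.not_ge
  have hdist : ∀ x y, Metric.infDist x K < Metric.infDist y K →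
      dist (φ (Metric.infDist x K)) (φ (Metric.infDist y K)) ≤ dist x y := by
    intro x y hxy
    refine (dist_triangle_max _ 0 _).trans (max_le ?_ ?_)
    · rw [dist_zero_right, hnorm]
      exact hxy.le.trans (hlt x y hxy)
    · rw [dist_zero_left, hnorm]
      exact hlt x y hxy
  refine ⟨fun x => φ (Metric.infDist x K), LipschitzWith.of_dist_le_mul fun x y => ?_,
    fun x => ?_⟩
  · rw [NNReal.coe_one, one_mul]
    rcases lt_trichotomy (Metric.infDist x K) (Metric.infDist y K) with h | h | h
    · exact hdist x y h
    · simp [h]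
    · rw [dist_comm, dist_comm x y]
      exact hdist y x h
  · rw [← norm_eq_zero, hnorm, hK.mem_iff_infDist_zero hne]

/-- If `h` is `1`-Lipschitz then `x ↦ x + p * h x` is an isometry of `ℤ_[p]`. -/
theorem PadicInt.exists_isometryEquiv_add_mul {p : ℕ} [hp : Fact p.Prime] {h : ℤ_[p] → ℤ_[p]}
    (hh : LipschitzWith 1 h) : ∃ e : ℤ_[p] ≃ᵢ ℤ_[p], ∀ x, e x = x + p * h x := by
  have hp1 : (p : ℝ)⁻¹ < 1 := inv_lt_one_of_one_lt₀ (by exact_mod_cast hp.out.one_lt)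
  have hle : ∀ x y, ‖(p : ℤ_[p]) * (h x - h y)‖ ≤ (p : ℝ)⁻¹ * ‖x - y‖ := by
    intro x y
    rw [norm_mul, PadicInt.norm_p]
    have := hh.dist_le_mul x y
    rw [NNReal.coe_one, one_mul, dist_eq_norm, dist_eq_norm] at this
    gcongr
  have hiso : Isometry fun x => x + (p : ℤ_[p]) * h x := by
    refine Isometry.of_dist_eq fun x y => ?_
    rcases eq_or_ne x y with rfl | hxy
    · simp
    have hlt : ‖(p : ℤ_[p]) * (h x - h y)‖ < ‖x - y‖ :=
      (hle x y).trans_lt (mul_lt_of_lt_one_left (norm_pos_iff.2 (sub_ne_zero.2 hxy)) hp1)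
    rw [dist_eq_norm, dist_eq_norm,
      show x + (p : ℤ_[p]) * h x - (y + p * h y) = (x - y) + p * (h x - h y) by ring,
      PadicInt.norm_add_eq_max_of_ne hlt.ne', max_eq_left hlt.le]
  have hsurj : Function.Surjective fun x => x + (p : ℤ_[p]) * h x := by
    intro y
    have hc : ContractingWith (p : NNReal)⁻¹ fun x => y - (p : ℤ_[p]) * h x := by
      refine ⟨by exact_mod_cast hp1, LipschitzWith.of_dist_le_mul fun u v => ?_⟩
      rw [dist_eq_norm, dist_eq_norm, norm_sub_rev u v,
        show y - (p : ℤ_[p]) * h u - (y - p * h v) = p * (h v - h u) by ring]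
      simpa using hle v u
    obtain ⟨x, hx, -⟩ := hc.exists_fixedPoint 0 (edist_ne_top _ _)
    refine ⟨x, ?_⟩
    have hx' : y - (p : ℤ_[p]) * h x = x := hx
    change x + (p : ℤ_[p]) * h x = y
    nth_rewrite 1 [← hx']
    ring
  exact ⟨IsometryEquiv.mk (Equiv.ofBijective _ ⟨hiso.injective, hsurj⟩) hiso, fun x => rfl⟩

theorem PadicInt.perfectSpace (p : ℕ) [hp : Fact p.Prime] : PerfectSpace ℤ_[p] := by
  rw [perfectSpace_iff_forall_not_isolated]
  intro x
  have hlim : Tendsto (fun n : ℕ => x + (p : ℤ_[p]) ^ n) atTop (𝓝[≠] x) := by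
    refine tendsto_nhdsWithin_iff.2 ⟨?_, Eventually.of_forall fun n => ?_⟩
    · have hp1 : ‖(p : ℤ_[p])‖ < 1 := by
        rw [PadicInt.norm_p]
        exact inv_lt_one_of_one_lt₀ (by exact_mod_cast hp.out.one_lt)
      simpa using (tendsto_pow_atTop_nhds_zero_of_norm_lt_one hp1).const_add x
    · have : (p : ℤ_[p]) ≠ 0 := by exact_mod_cast hp.out.ne_zero
      simp [this]
  exact hlim.neBot

/-- A separable perfect space contains a closed set with empty interior and positive measure. -/
theorem exists_isClosed_dense_compl_measure_pos {X : Type*} [MetricSpace X]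
    [TopologicalSpace.SeparableSpace X] [MeasurableSpace X] [BorelSpace X]
    (μ : Measure X) [IsProbabilityMeasure μ] [NullSingletonClass μ] :
    ∃ K : Set X, IsClosed K ∧ Dense Kᶜ ∧ 0 < μ K := by
  obtain ⟨s, hs, hd⟩ := TopologicalSpace.exists_countable_dense X
  obtain ⟨V, hsV, hV, hμ⟩ := s.exists_isOpen_lt_of_lt (μ := μ) 1 (by simp [hs.measure_zero μ])
  refine ⟨Vᶜ, hV.isClosed_compl, by simpa using hd.mono hsV, ?_⟩
  rw [prob_compl_eq_one_sub hV.measurableSet]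
  exact tsub_pos_of_lt hμ

theorem IsometryEquiv.addLeft_one_zpow_apply {R : Type*} [NormedRing R] (n : ℤ) (x : R) :
    ((IsometryEquiv.addLeft (1 : R)) ^ n) x = n + x := by
  induction n generalizing x with
  | zero => simp
  | succ n ih =>
    rw [zpow_add_one, IsometryEquiv.mul_apply, ih]
    simp [add_assoc]
  | pred n ih =>
    rw [zpow_sub_one, IsometryEquiv.mul_apply, ih]
    have : (IsometryEquiv.addLeft (1 : R))⁻¹ x = -1 + x := rfl
    rw [this]
    push_cast
    abel

instance IsometryEquiv.subgroupMulAction {X : Type*} [PseudoEMetricSpace X]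
    (H : Subgroup (X ≃ᵢ X)) : MulAction H X where
  smul g x := (g : X ≃ᵢ X) x
  one_smul _ := rfl
  mul_smul _ _ _ := rfl

/-- There exist a Cantor set `X`, a finitely generated group `G` acting
minimally and equicontinuously on `X` by homeomorphisms, and a `G`-invariant Borel
probability measure `μ` on `X`, such that the set of points without holonomy has measure
zero (i.e. the set of points with non-trivial holonomy has full measure). -/
theorem statement13 :
    ∃ (X : Type) (_ : MetricSpace X) (_ : MeasurableSpace X) (G : Type) (_ : Group G)
      (_ : MulAction G X) (μ : Measure X),
      BorelSpace X ∧ CompactSpace X ∧ Nonempty X ∧ TotallyDisconnectedSpace X ∧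
      Perfect (Set.univ : Set X) ∧ Group.FG G ∧
      (∀ g : G, Continuous fun x : X => g • x) ∧
      (∀ x : X, Dense (MulAction.orbit G x)) ∧
      Equicontinuous (fun g : G => fun x : X => g • x) ∧
      IsProbabilityMeasure μ ∧
      (∀ g : G, Measure.map (fun x : X => g • x) μ = μ) ∧
      μ {x : X | ∀ g : G, g • x = x →
          ∃ U : Set X, IsOpen U ∧ x ∈ U ∧ ∀ y ∈ U, g • y = y} = 0 := by
  borelize ℤ_[2]
  have : PerfectSpace ℤ_[2] := PadicInt.perfectSpace 2
  let μ : Measure ℤ_[2] := Measure.addHaarMeasure ⊤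
  have : IsProbabilityMeasure μ := ⟨Measure.addHaarMeasure_self (K₀ := ⊤)⟩
  obtain ⟨K, hK, hKd, hKμ⟩ := exists_isClosed_dense_compl_measure_pos μ
  obtain ⟨h, hh, hh0⟩ :=
    PadicInt.exists_lipschitzWith_one_zero_iff hK (nonempty_of_measure_ne_zero hKμ.ne')
  obtain ⟨e, he⟩ := PadicInt.exists_isometryEquiv_add_mul hh
  have heK : ∀ x, e x = x ↔ x ∈ K := by
    intro x
    rw [he, ← hh0]
    simp
  let a : ℤ_[2] ≃ᵢ ℤ_[2] := IsometryEquiv.addLeft 1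
  let G : Subgroup (ℤ_[2] ≃ᵢ ℤ_[2]) := Subgroup.closure {a, e}
  have ha : a ∈ G := Subgroup.subset_closure (by simp)
  have heG : e ∈ G := Subgroup.subset_closure (by simp)
  have hdense : DenseRange fun n : ℤ => (n : ℤ_[2]) := PadicInt.denseRange_intCast
  refine ⟨ℤ_[2], inferInstance, inferInstance, G, inferInstance, inferInstance, μ,
    inferInstance, inferInstance, inferInstance, inferInstance, PerfectSpace.univ_perfect _,
    Group.closure_finite_fg _, fun g => g.1.continuous, fun x => ?_, ?_, inferInstance,
    fun g => IsometryEquiv.map_eq_of_isAddLeftInvariant μ g.1, ?_⟩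
  · have hx : DenseRange fun n : ℤ => (n : ℤ_[2]) + x :=
      (Homeomorph.addRight x).surjective.denseRange.comp hdense (Homeomorph.addRight x).continuous
    refine hx.mono ?_
    rintro _ ⟨n, rfl⟩
    exact ⟨⟨a ^ n, zpow_mem ha n⟩, IsometryEquiv.addLeft_one_zpow_apply n x⟩
  · refine (Metric.uniformEquicontinuous_of_continuity_modulus id tendsto_id _ ?_).equicontinuous
    exact fun x y g => (g.1.dist_eq x y).le
  · have herg : Ergodic (fun x : ℤ_[2] => 1 + x) μ :=
      ergodic_add_left_of_denseRange_zsmul (by simpa using hdense) μ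
    have hT : MeasurableSet (⋃ n : ℤ, (a ^ n) ⁻¹' K) :=
      MeasurableSet.iUnion fun n => (hK.preimage (a ^ n).continuous).measurableSet
    have hTa : (fun x : ℤ_[2] => 1 + x) ⁻¹' (⋃ n : ℤ, (a ^ n) ⁻¹' K) =
        ⋃ n : ℤ, (a ^ n) ⁻¹' K := by
      rw [Set.preimage_iUnion]
      refine Set.iUnion_congr_of_surjective _ (Equiv.addRight (1 : ℤ)).surjective fun n => ?_
      rw [Equiv.coe_addRight, zpow_add_one]
      rfl
    have hnull : μ (⋃ n : ℤ, (a ^ n) ⁻¹' K)ᶜ = 0 := by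
      rcases herg.toPreErgodic.measure_self_or_compl_eq_zero hT hTa with h0 | h0
      · refine absurd (measure_mono_null ?_ h0) hKμ.ne'
        exact fun x hx => Set.mem_iUnion.2 ⟨0, hx⟩
      · exact h0
    refine measure_mono_null ?_ hnull
    intro x hx hxT
    obtain ⟨n, hn⟩ := Set.mem_iUnion.1 hxT
    have hfix : ∀ y, ((a ^ n)⁻¹ * e * a ^ n) y = y ↔ (a ^ n) y ∈ K := by
      intro y
      rw [← heK, IsometryEquiv.mul_apply, IsometryEquiv.mul_apply]
      exact (a ^ n).symm_apply_eq
    have hmem : (a ^ n)⁻¹ * e * a ^ n ∈ G :=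
      mul_mem (mul_mem (inv_mem (zpow_mem ha n)) heG) (zpow_mem ha n)
    obtain ⟨U, hU, hxU, hUfix⟩ := hx ⟨_, hmem⟩ ((hfix x).2 hn)
    obtain ⟨z, ⟨y, hy, rfl⟩, hz⟩ := hKd.inter_open_nonempty ((a ^ n) '' U)
      ((a ^ n).toHomeomorph.isOpenMap U hU) ⟨_, x, hxU, rfl⟩
    exact hz ((hfix y).1 (hUfix y hy))
end

section
/- Let G be a countable group acting by homeomorphisms on a Hausdorff topological space X. Then the stabilizer map St : X → (G → Bool) is continuous at a point x ∈ X if and only if x is a point without holonomy, i.e. for every g ∈ G with g·x = x there is an open neighborhood of x fixed pointwise by g. -/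
/-- The stabilizer map, sending a point to the characteristic function (in `G → Bool`) of
its stabilizer. The space `G → Bool` carries the product topology (`Bool` discrete), which
for a countable discrete group realizes the Chabauty–Fell topology on subgroups of `G`. -/
noncomputable def St {G : Type*} {X : Type*} [Group G] [MulAction G X] (x : X) :
    G → Bool :=
  fun g => @decide (g • x = x) (Classical.propDecidable _)

/-- For a countable group acting by homeomorphisms on a Hausdorff space, the
stabilizer map `St : X → (G → Bool)` is continuous at `x` iff `x` is a point without
holonomy. -/
theorem statement14 {X : Type*} [TopologicalSpace X] [T2Space X]
    {G : Type*} [Group G] [Countable G] [MulAction G X]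
    (hcont : ∀ g : G, Continuous fun x : X => g • x) (x : X) :
    ContinuousAt (St (G := G) (X := X)) x ↔
      ∀ g : G, g • x = x → ∃ U : Set X, IsOpen U ∧ x ∈ U ∧ ∀ y ∈ U, g • y = y := by
  rw [ContinuousAt, tendsto_pi_nhds]
  simp only [nhds_discrete, Filter.tendsto_pure]
  have eq_iff (g : G) (y : X) : St y g = St x g ↔ (g • y = y ↔ g • x = x) := by
    simp [St]
  simp only [eq_iff]
  constructor
  · intro h g hg
    obtain ⟨U, hU, hUo, hxU⟩ := eventually_nhds_iff.mp (h g)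
    exact ⟨U, hUo, hxU, fun y hy => (hU y hy).mpr hg⟩
  · intro h g
    by_cases hg : g • x = x
    · obtain ⟨U, hUo, hxU, hU⟩ := h g hg
      filter_upwards [hUo.mem_nhds hxU] with y hy
      exact iff_of_true (hU y hy) hg
    · have hopen : IsOpen {y : X | g • y ≠ y} :=
        isOpen_ne_fun (hcont g) continuous_id
      filter_upwards [hopen.mem_nhds hg] with y hy
      exact iff_of_false hy hg
end

section
/- Let G be a countable group acting by homeomorphisms on a Hausdorff topological space X. Suppose a sequence of points (x_k) converges to x in X and the sequence of characteristic functions St(x_k) converges pointwise to a function f : G → Bool. Then [G]_x ⊆ {g ∈ G : f(g) = true} ⊆ G_x, where [G]_x = {g ∈ G : g fixes pointwise some open neighborhood of x} is the neighborhood stabilizer of x and G_x is the stabilizer of x. -/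
open Filter

/-- The characteristic function of the stabilizer of `x` is true at `g` iff `g` fixes `x`. -/
theorem St_apply_eq_true_iff {G : Type*} {X : Type*} [Group G] [MulAction G X] (x : X) (g : G) :
    St x g = true ↔ g • x = x := by
  simp [St]

/-- If `x k → x` and the characteristic functions `St (x k)` converge
pointwise to `f : G → Bool`, then `[G]_x ⊆ {g | f g = true} ⊆ G_x`, where `[G]_x` is the
neighborhood stabilizer and `G_x` the stabilizer of `x`. -/
theorem statement15 {X : Type*} [TopologicalSpace X] [T2Space X]
    {G : Type*} [Group G] [Countable G] [MulAction G X]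
    (hcont : ∀ g : G, Continuous fun y : X => g • y)
    (x : ℕ → X) (x₀ : X) (hx : Tendsto x atTop (nhds x₀))
    (f : G → Bool)
    (hf : ∀ g : G, Tendsto (fun k : ℕ => St (x k) g) atTop (nhds (f g))) :
    (∀ g : G, (g • x₀ = x₀ ∧ ∃ V : Set X, IsOpen V ∧ x₀ ∈ V ∧ ∀ y ∈ V, g • y = y) →
        f g = true) ∧
    (∀ g : G, f g = true → g • x₀ = x₀) := by
  have hev : ∀ g : G, ∀ᶠ k in atTop, St (x k) g = f g := fun g =>
    (hf g).eventually_mem ((isOpen_discrete {f g}).mem_nhds rfl)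
  refine ⟨?_, fun g hg => ?_⟩
  · rintro g ⟨-, V, hV, hxV, hfix⟩
    obtain ⟨k, hk, hkV⟩ := ((hev g).and (hx.eventually_mem (hV.mem_nhds hxV))).exists
    rw [← hk, St_apply_eq_true_iff]
    exact hfix _ hkV
  · refine tendsto_nhds_unique (((hcont g).tendsto x₀).comp hx) (hx.congr' ?_)
    filter_upwards [hev g] with k hk
    exact ((St_apply_eq_true_iff _ _).1 (hk.trans hg)).symm
end

section
/- Let X be a Cantor set with a fixed compatible metric, G a finitely generated group acting minimally and equicontinuously on X by homeomorphisms, and μ a G-invariant Borel probability measure on X such that the set X₀ of points without holonomy has full μ-measure. Let ν be the pushforward of μ under the stabilizer map St : X → (G → Bool). Then the action is not locally quasi-analytic if and only if ν is non-atomic, i.e. ν({f}) = 0 for every f ∈ (G → Bool). -/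
open MeasureTheory

/-- A finite family of closed sets is trivialized by some nonempty open set: each member either
contains it or is disjoint from it. -/
theorem exists_isOpen_subset_or_disjoint {X ι : Type*} [TopologicalSpace X] [Nonempty X]
    {F : ι → Set X} {s : Set ι} (hs : s.Finite) (hF : ∀ i, IsClosed (F i)) :
    ∃ U : Set X, IsOpen U ∧ U.Nonempty ∧ ∀ i ∈ s, U ⊆ F i ∨ Disjoint U (F i) := by
  induction s, hs using Set.Finite.induction_on with
  | empty => exact ⟨Set.univ, isOpen_univ, Set.univ_nonempty, by simp⟩
  | @insert a s _ _ ih =>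
    obtain ⟨U, hU, hne, h⟩ := ih
    by_cases hsub : U ⊆ F a
    · refine ⟨U, hU, hne, ?_⟩
      rintro i (rfl | hi)
      · exact Or.inl hsub
      · exact h i hi
    · refine ⟨U \ F a, hU.sdiff (hF a), Set.sdiff_nonempty.2 hsub, ?_⟩
      rintro i (rfl | hi)
      · exact Or.inr Set.disjoint_sdiff_left
      · exact (h i hi).imp Set.sdiff_subset.trans fun hd => hd.mono_left Set.sdiff_subset

section

variable {G X : Type*} [Group G] [MulAction G X]

theorem St_eq_true_iff {x : X} {g : G} : St x g = true ↔ g • x = x := by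
  simp [St]

theorem St_eq_iff {x y : X} :
    St (G := G) x = St y ↔ ∀ g : G, g • x = x ↔ g • y = y := by
  rw [funext_iff]
  exact forall_congr' fun g => by rw [Bool.eq_iff_iff, St_eq_true_iff, St_eq_true_iff]

theorem St_smul_eq_iff {x y : X} (g : G) :
    St (G := G) (g • x) = St (g • y) ↔ St (G := G) x = St y := by
  have key (h : G) (z : X) : h • g • z = g • z ↔ (g⁻¹ * h * g) • z = z := by
    simp only [mul_smul, inv_smul_eq_iff]
  simp only [St_eq_iff, key]
  refine ⟨fun H h => ?_, fun H h => H _⟩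
  simpa [mul_assoc] using H (g * h * g⁻¹)

theorem measurable_St [TopologicalSpace X] [T2Space X] [MeasurableSpace X]
    [OpensMeasurableSpace X] [ContinuousConstSMul G X] :
    Measurable (St (G := G) (X := X)) := by
  refine measurable_pi_lambda _ fun g => measurable_to_bool ?_
  have : (fun x : X => St x g) ⁻¹' {true} = {x | g • x = x} := by
    ext x; simp [St_eq_true_iff]
  rw [this]
  exact (isClosed_eq (continuous_const_smul g) continuous_id).measurableSet

theorem exists_smul_mem_of_dense_orbit [TopologicalSpace X]
    (hmin : ∀ x : X, Dense (MulAction.orbit G x)) {U : Set X} (hU : IsOpen U)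
    (hne : U.Nonempty) (x : X) : ∃ g : G, g • x ∈ U := by
  obtain ⟨_, hy, g, rfl⟩ := (hmin x).inter_open_nonempty U hU hne
  exact ⟨g, hy⟩

theorem measurableSet_withoutHolonomy [Countable G] [TopologicalSpace X] [T2Space X]
    [MeasurableSpace X] [OpensMeasurableSpace X] [ContinuousConstSMul G X] :
    MeasurableSet {x : X | ∀ g : G, g • x = x →
      ∃ U : Set X, IsOpen U ∧ x ∈ U ∧ ∀ y ∈ U, g • y = y} := by
  have key : {x : X | ∀ g : G, g • x = x →
      ∃ U : Set X, IsOpen U ∧ x ∈ U ∧ ∀ y ∈ U, g • y = y} =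
      ⋂ g : G, ({x : X | g • x = x}ᶜ ∪ interior {x : X | g • x = x}) := by
    ext x
    rw [Set.mem_iInter]
    refine forall_congr' fun g => imp_iff_not_or.trans (or_congr_right ?_)
    rw [mem_interior]
    exact exists_congr fun U => ⟨fun ⟨h1, h2, h3⟩ => ⟨h3, h1, h2⟩, fun ⟨h3, h1, h2⟩ => ⟨h1, h2, h3⟩⟩
  rw [key]
  exact MeasurableSet.iInter fun g =>
    (isClosed_eq (continuous_const_smul g) continuous_id).measurableSet.compl.union
      isOpen_interior.measurableSet

/-- An invariant nonzero measure of a minimal action of a countable group has full support. -/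
theorem measure_ne_zero_of_dense_orbit [Countable G] [TopologicalSpace X] [MeasurableSpace X]
    [OpensMeasurableSpace X] (hmin : ∀ x : X, Dense (MulAction.orbit G x))
    {μ : Measure X} [NeZero μ] (hμ : ∀ g : G, MeasurePreserving (g • · : X → X) μ μ)
    {U : Set X} (hU : IsOpen U) (hne : U.Nonempty) : μ U ≠ 0 := by
  intro h0
  refine NeZero.ne (μ Set.univ) (measure_mono_null (t := ⋃ g : G, (g • · : X → X) ⁻¹' U) ?_ ?_)
  · intro x _
    exact Set.mem_iUnion.2 (exists_smul_mem_of_dense_orbit hmin hU hne x)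
  · refine measure_iUnion_null fun g => ?_
    rw [(hμ g).measure_preimage hU.measurableSet.nullMeasurableSet, h0]

/-- For a minimal action, the stabilizers along an orbit that carries an atom of the stabilizer
distribution form a finite set. -/
theorem finite_range_St_smul [TopologicalSpace X] [T2Space X] [MeasurableSpace X]
    [OpensMeasurableSpace X] [Countable G] [ContinuousConstSMul G X] {μ : Measure X}
    [IsFiniteMeasure μ] (hμ : ∀ g : G, MeasurePreserving (g • · : X → X) μ μ) {x : X}
    (hx : μ (St (G := G) ⁻¹' {St x}) ≠ 0) :
    (Set.range fun g : G => St (G := G) (g • x)).Finite := by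
  have hmeas (f : G → Bool) : MeasurableSet (St (G := G) (X := X) ⁻¹' {f}) :=
    measurable_St (measurableSet_singleton f)
  refine (Measure.finite_const_le_meas_of_disjoint_iUnion μ (pos_iff_ne_zero.2 hx) hmeas
    (fun f f' hne => (Set.disjoint_singleton.2 hne).preimage _) (measure_ne_top _ _)).subset ?_
  rintro _ ⟨g, rfl⟩
  rw [Set.mem_ofPred_eq, ← (hμ g).measure_preimage (hmeas (St (g • x))).nullMeasurableSet]
  exact measure_mono fun y hy => (St_smul_eq_iff g).2 hy

end

/-- A minimal action on a compact space is locally quasi-analytic as soon as, on one nonempty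
open set, every element fixing a nonempty open subset is the identity. -/
theorem isLQA_of_exists_isOpen {G X : Type*} [Group G] [MetricSpace X] [CompactSpace X]
    [MulAction G X] [ContinuousConstSMul G X] (hmin : ∀ x : X, Dense (MulAction.orbit G x))
    {W : Set X} (hW : IsOpen W) (hne : W.Nonempty)
    (hfix : ∀ V ⊆ W, IsOpen V → V.Nonempty → ∀ k : G, (∀ v ∈ V, k • v = v) →
      ∀ u ∈ W, k • u = u) : IsLQA G X := by
  obtain ⟨ε, hε, hball⟩ := lebesgue_number_lemma_of_metric (s := Set.univ)
    (c := fun g : G => (g • · : X → X) ⁻¹' W) isCompact_univ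
    (fun g => hW.preimage (continuous_const_smul g))
    (fun x _ => Set.mem_iUnion.2 (exists_smul_mem_of_dense_orbit hmin hW hne x))
  refine ⟨ε, hε, fun U _ hdiam V hVU hV ⟨v, hv⟩ g₁ g₂ hag u hu => ?_⟩
  obtain ⟨g, hg⟩ := hball v trivial
  have hUg (y : X) (hy : y ∈ U) : g • y ∈ W :=
    hg ((Metric.dist_le_diam_of_mem (Metric.isBounded_of_compactSpace) hy (hVU hv)).trans_lt hdiam)
  have key := hfix ((g⁻¹ • · : X → X) ⁻¹' V)
    (fun y hy => by simpa using hUg _ (hVU hy)) (hV.preimage (continuous_const_smul _))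
    ⟨g • v, by simpa using hv⟩ (g * (g₁⁻¹ * g₂) * g⁻¹)
    (fun y hy => by
      rw [mul_smul, mul_smul, mul_smul, ← hag _ hy, inv_smul_smul, smul_inv_smul])
    (g • u) (hUg u hu)
  rw [mul_smul, inv_smul_smul, mul_smul, smul_left_cancel_iff, mul_smul, inv_smul_eq_iff] at key
  exact key.symm

/-- For a minimal equicontinuous action of a finitely generated group on a
Cantor set with invariant Borel probability measure `μ` such that the set of points without
holonomy has full measure, the action is not locally quasi-analytic iff the pushforward
`ν = St_* μ` is non-atomic. -/
theorem statement18 {X : Type*} [MetricSpace X] [CompactSpace X] [Nonempty X]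
    [TotallyDisconnectedSpace X] (hperf : Perfect (Set.univ : Set X))
    [MeasurableSpace X] [BorelSpace X]
    {G : Type*} [Group G] (hfg : Group.FG G) [MulAction G X]
    (hcont : ∀ g : G, Continuous fun x : X => g • x)
    (hmin : ∀ x : X, Dense (MulAction.orbit G x))
    (hequi : Equicontinuous (fun g : G => fun x : X => g • x))
    (μ : Measure X) [IsProbabilityMeasure μ]
    (hinvμ : ∀ g : G, Measure.map (fun x : X => g • x) μ = μ)
    (hfull : μ {x : X | ∀ g : G, g • x = x →
        ∃ U : Set X, IsOpen U ∧ x ∈ U ∧ ∀ y ∈ U, g • y = y} = 1) :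
    ¬ IsLQA G X ↔
      ∀ f : G → Bool, Measure.map (St (G := G) (X := X)) μ {f} = 0 := by
  have : Countable G := by
    obtain ⟨S, hS, φ, hφ⟩ := Group.fg_iff_exists_freeGroup_hom_surjective.1 hfg
    have := hS.countable.to_subtype
    exact hφ.countable
  have : ContinuousConstSMul G X := ⟨hcont⟩
  have hμ (g : G) : MeasurePreserving (g • · : X → X) μ μ :=
    ⟨(hcont g).measurable, hinvμ g⟩
  have hclosed (g : G) : IsClosed {x : X | g • x = x} := isClosed_eq (hcont g) continuous_id
  have hmap (f : G → Bool) :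
      Measure.map (St (G := G) (X := X)) μ {f} = μ (St (G := G) (X := X) ⁻¹' {f}) :=
    Measure.map_apply measurable_St (measurableSet_singleton f)
  simp only [hmap]
  constructor
  · intro hL f
    by_contra hf
    obtain ⟨x, rfl⟩ := nonempty_of_measure_ne_zero hf
    obtain ⟨W, hW, hWne, hWF⟩ := exists_isOpen_subset_or_disjoint
      (F := fun φ : G → Bool => ⋂ (g : G) (_ : φ g = true), {y : X | g • y = y})
      (finite_range_St_smul hμ hf) (fun φ => isClosed_biInter fun g _ => hclosed g)
    refine hL (isLQA_of_exists_isOpen hmin hW hWne fun V hVW hV hVne k hk u hu => ?_)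
    obtain ⟨g, hg⟩ := exists_smul_mem_of_dense_orbit hmin hV hVne x
    rcases hWF _ ⟨g, rfl⟩ with hsub | hdis
    · exact Set.mem_iInter₂.1 (hsub hu) k (St_eq_true_iff.2 (hk _ hg))
    · refine (Set.disjoint_left.1 hdis (hVW hg) ?_).elim
      exact Set.mem_iInter₂.2 fun h hh => St_eq_true_iff.1 hh
  · rintro hatom ⟨ε, hε, hq⟩
    have hX₀ := (prob_compl_eq_zero_iff measurableSet_withoutHolonomy).2 hfull
    obtain ⟨p⟩ := ‹Nonempty X›
    set U := Metric.ball p (ε / 3)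
    have hdiam : Metric.diam U < ε :=
      (Metric.diam_ball (by positivity)).trans_lt (by linarith)
    have hpos : μ (U ∩ {x : X | ∀ g : G, g • x = x →
        ∃ U : Set X, IsOpen U ∧ x ∈ U ∧ ∀ y ∈ U, g • y = y}) ≠ 0 := by
      rw [measure_inter_conull hX₀]
      exact measure_ne_zero_of_dense_orbit hmin hμ Metric.isOpen_ball
        ⟨p, Metric.mem_ball_self (by positivity)⟩
    have hfix {x : X} (hx : x ∈ U) {g : G}
        (hol : ∃ V : Set X, IsOpen V ∧ x ∈ V ∧ ∀ y ∈ V, g • y = y)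
        {y : X} (hy : y ∈ U) : g • y = y := by
      obtain ⟨V, hV, hxV, hVfix⟩ := hol
      simpa using hq U Metric.isOpen_ball hdiam (U ∩ V) Set.inter_subset_left
        (Metric.isOpen_ball.inter hV) ⟨x, hx, hxV⟩ g 1
        (fun v hv => by simpa using hVfix v hv.2) y hy
    obtain ⟨x, hx⟩ := nonempty_of_measure_ne_zero hpos
    exact hpos (measure_mono_null (fun y hy => St_eq_iff.2 fun g =>
      ⟨fun h => hfix hy.1 (hy.2 g h) hx.1, fun h => hfix hx.1 (hx.2 g h) hy.1⟩) (hatom (St x)))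
end
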